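/- arXiv:1406.0867 — 4 statements merged into one kernel-verified Lean document; each statement's English description precedes it below -/
import Mathlib

section
/- Let k be a field of characteristic zero and let A be a finitely generated integrally closed k-algebra that is an integral domain, equipped with a k-linear derivation δ. Then there is a finite-dimensional k-vector subspace W of A with the property that for every nonzero f ∈ A such that δ(f)/f ∈ A (i.e., δ(f) = f·g for some g ∈ A), one has δ(f)/f ∈ W (i.e., g ∈ W). -/
theorem exists_derivation_extend (k A K : Type*) [Field k] [CommRing A] [IsDomain A] [Algebra k A]
    [Field K] [Algebra A K] [IsFractionRing A K] [Algebra k K] [IsScalarTower k A K]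
    (δ : Derivation k A A) :
    ∃ D : Derivation k K K, ∀ a, D (algebraMap A K a) = algebraMap A K (δ a) := by
  let M := nonZeroDivisors A
  let φ := KaehlerDifferential.map k k A K
  have hu : ∀ x : M, IsUnit ((algebraMap A (Module.End A K)) x) := 
    IsLocalizedModule.map_units (Algebra.linearMap A K)
  let l : Ω[K⁄k] →ₗ[A] K := IsLocalizedModule.lift M φ
    ((Algebra.linearMap A K) ∘ₗ δ.liftKaehlerDifferential) hu
  let l' : Ω[K⁄k] →ₗ[K] K := l.extendScalarsOfIsLocalization M K
  refine ⟨l'.compDer (KaehlerDifferential.D k K), fun a => ?_⟩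
  have h := IsLocalizedModule.lift_apply M φ
    ((Algebra.linearMap A K) ∘ₗ δ.liftKaehlerDifferential) hu (KaehlerDifferential.D k A a)
  simp [φ] at h; exact h

theorem log_bound {k R L K : Type*} [CommRing R] [IsDomain R] [IsDiscreteValuationRing R]
    [Field L] [Algebra R L] [IsFractionRing R L] [Field K] [Algebra L K] [Algebra R K]
    [IsScalarTower R L K] [FiniteDimensional L K] [Algebra.IsSeparable L K]
    [Field k] [Algebra k K] (D : Derivation k K K) (N : Submodule R K) (hN : N.FG)
    (hD : ∀ r : R, D (algebraMap R K r) ∈ N) :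
    ∃ M : Submodule R K, M.FG ∧ ∀ f : K, f ≠ 0 → D f / f ∈ M := by
  classical
  let S := integralClosure R K
  have : IsDedekindDomain S := integralClosure.isDedekindDomain R L K
  have : Module.Finite R S := IsIntegralClosure.finite R L K S
  have : IsFractionRing S K := IsIntegralClosure.isFractionRing_of_finite_extension R L K S
  have hfin : {I : Ideal S | I.IsMaximal}.Finite := by
    refine (Algebra.QuasiFinite.finite_primesOver (S := S) (IsLocalRing.maximalIdeal R)).subset ?_
    intro I hI
    have hI' : I.IsMaximal := hI
    refine ⟨hI'.isPrime, ⟨?_⟩⟩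
    exact (IsLocalRing.eq_maximalIdeal (Ideal.isMaximal_comap_of_isIntegral_of_isMaximal I)).symm
  have : IsPrincipalIdealRing S := IsPrincipalIdealRing.of_finite_maximals hfin
  obtain ⟨T, hT⟩ := (Module.finite_def.mp ‹Module.Finite R S›)
  let S' : Submodule R K := Subalgebra.toSubmodule S
  have hS'fg : S'.FG := (Submodule.fg_top S').mp (Module.finite_def.mp ‹Module.Finite R S›)
  have hone : (1 : K) ∈ S' := one_mem S
  let Q : Submodule R K := N ⊔ Submodule.span R ((fun t : S => D (t : K)) '' (T : Set S))
  have hQ : Q.FG := hN.sup (Submodule.fg_span (T.finite_toSet.image _))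
  let M0 : Submodule R K := S' * Q
  have hM0 : M0.FG := hS'fg.mul hQ
  have hmulM0 : ∀ s ∈ S', ∀ m ∈ M0, s * m ∈ M0 := by
    intro s hs m hm
    have h1 : S' * M0 = M0 := by
      change S' * (S' * Q) = S' * Q
      rw [← mul_assoc]; congr 1; exact Subalgebra.isIdempotentElem_toSubmodule S
    rw [← h1]
    exact Submodule.mul_mem_mul hs hm
  have hQM : Q ≤ M0 := fun x hx => by simpa using Submodule.mul_mem_mul hone hx
  have hDS : ∀ s : S, D (s : K) ∈ M0 := by
    intro s
    have hs : s ∈ Submodule.span R (T : Set S) := hT ▸ Submodule.mem_top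
    induction hs using Submodule.span_induction with
    | mem x hx => exact hQM (Submodule.mem_sup_right (Submodule.subset_span ⟨x, hx, rfl⟩))
    | zero => simp
    | add x y _ _ hx hy => simpa using add_mem hx hy
    | smul r x _ hx =>
      have : ((r • x : S) : K) = algebraMap R K r * x := by
        rw [← Algebra.smul_def]; rfl
      rw [this, D.leibniz]
      refine add_mem ?_ ?_
      · rw [smul_eq_mul, ← Algebra.smul_def]; exact M0.smul_mem r hx
      · exact hmulM0 _ x.2 _ (hQM (Submodule.mem_sup_left (hD r)))
  let gen : Ideal S → S := fun I => Submodule.IsPrincipal.generator I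
  let P : Set K := (fun I : Ideal S => D (gen I : K) / (gen I : K)) '' {I : Ideal S | I.IsMaximal}
  let M : Submodule R K := M0 ⊔ Submodule.span R P
  have hmul : ∀ a b : K, a ≠ 0 → b ≠ 0 → D (a * b) / (a * b) = D a / a + D b / b := by
    intro a b ha hb
    rw [D.leibniz, smul_eq_mul, smul_eq_mul]; field_simp; ring
  have hunit : ∀ u : S, IsUnit u → D (u : K) / (u : K) ∈ M := by
    rintro _ ⟨u, rfl⟩
    refine Submodule.mem_sup_left ?_
    have h1 : ((u : S) : K) * ((u⁻¹ : Sˣ) : S) = 1 := by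
      rw [← MulMemClass.coe_mul, Units.mul_inv]; rfl
    have h2 : ((u : S) : K)⁻¹ = ((u⁻¹ : Sˣ) : S) := inv_eq_of_mul_eq_one_right h1
    rw [div_eq_mul_inv, mul_comm, h2]
    exact hmulM0 _ (Subtype.prop _) _ (hDS _)
  have hprime : ∀ p : S, Prime p → D (p : K) / (p : K) ∈ M := by
    intro p hp
    have hI : (Ideal.span {p} : Ideal S).IsMaximal :=
      ((Ideal.span_singleton_prime hp.ne_zero).mpr hp).isMaximal
        (by simpa using hp.ne_zero)
    have hassoc : Associated (gen (Ideal.span {p})) p := by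
      rw [← Ideal.span_singleton_eq_span_singleton]
      exact Ideal.span_singleton_generator _
    obtain ⟨u, hu⟩ := hassoc
    have h0 : ((gen (Ideal.span {p}) : S) : K) ≠ 0 := by
      intro h
      apply hp.ne_zero
      rw [← hu, Subtype.ext (a1 := gen (Ideal.span {p})) (a2 := 0) h, zero_mul]
    have h1 : ((u : S) : K) ≠ 0 := by
      intro h
      exact u.ne_zero (Subtype.ext h)
    rw [← hu, MulMemClass.coe_mul, hmul _ _ h0 h1]
    refine add_mem (Submodule.mem_sup_right (Submodule.subset_span ⟨_, hI, rfl⟩)) (hunit _ u.isUnit)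
  have hS : ∀ a : S, a ≠ 0 → D (a : K) / (a : K) ∈ M := by
    intro a
    induction a using UniqueFactorizationMonoid.induction_on_prime with
    | h₁ => simp
    | h₂ x hx => exact fun _ => hunit x hx
    | h₃ a p ha hp ih =>
      intro _
      rw [MulMemClass.coe_mul, hmul _ _ (by simpa using hp.ne_zero) (by simpa using ha)]
      exact add_mem (hprime p hp) (ih ha)
  refine ⟨M, hM0.sup (Submodule.fg_span (hfin.image _)), fun f hf => ?_⟩
  obtain ⟨a, b, hb, rfl⟩ := IsFractionRing.div_surjective (A := S) f
  have hb0 : b ≠ 0 := nonZeroDivisors.ne_zero hb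
  have ha0 : a ≠ 0 := by rintro rfl; simp at hf
  have hbK : (algebraMap S K b) ≠ 0 := by simpa using hb0
  have h := hmul _ _ hf hbK
  rw [div_mul_cancel₀ _ hbK] at h
  rw [← sub_eq_iff_eq_add.mpr h]
  exact sub_mem (hS a ha0) (hS b hb0)
open Classical in
noncomputable def degVal (σ k : Type*) [Field k] : Valuation (MvPolynomial σ k) (WithZero (Multiplicative ℤ)) where
  toFun p := if p = 0 then 0 else WithZero.exp (p.totalDegree : ℤ)
  map_zero' := by simp
  map_one' := by simp
  map_mul' p q := by
    by_cases hp : p = 0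
    · simp [hp]
    by_cases hq : q = 0
    · simp [hq]
    simp [hp, hq, MvPolynomial.totalDegree_mul_of_isDomain hp hq, WithZero.exp_add]
  map_add_le_max' p q := by
    by_cases hp : p = 0
    · simp [hp]
    by_cases hq : q = 0
    · simp [hq]
    by_cases hpq : p + q = 0
    · simp [hpq]
    simp only [hp, hq, hpq, if_false]
    rw [le_max_iff, WithZero.exp_le_exp, WithZero.exp_le_exp]
    have := MvPolynomial.totalDegree_add p q
    rw [le_max_iff] at this
    exact_mod_cast this

theorem degVal_apply {σ k : Type*} [Field k] {p : MvPolynomial σ k} (hp : p ≠ 0) :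
    degVal σ k p = WithZero.exp (p.totalDegree : ℤ) := by
  simp [degVal, hp]

theorem degVal_supp {σ k : Type*} [Field k] :
    nonZeroDivisors (MvPolynomial σ k) ≤ (degVal σ k).supp.primeCompl := by
  intro p hp
  have := nonZeroDivisors.ne_zero hp
  change p ∉ (degVal σ k).supp
  rw [Valuation.mem_supp_iff, degVal_apply this]
  simp

theorem degVal_pderiv {σ k : Type*} [Field k] (i : σ) (p : MvPolynomial σ k) :
    degVal σ k (MvPolynomial.pderiv i p) ≤ degVal σ k p := by
  by_cases h : MvPolynomial.pderiv i p = 0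
  · simp [h]
  have hp : p ≠ 0 := by rintro rfl; simp at h
  rw [degVal_apply h, degVal_apply hp, WithZero.exp_le_exp]
  norm_cast
  conv_lhs => rw [p.as_sum, map_sum]
  refine MvPolynomial.totalDegree_finsetSum_le fun s hs => ?_
  rw [MvPolynomial.pderiv_monomial]
  refine (MvPolynomial.totalDegree_monomial_le _ _).trans ?_
  refine le_trans ?_ (MvPolynomial.le_totalDegree hs)
  have : s - Finsupp.single i 1 ≤ s := tsub_le_self
  exact Finsupp.degree_mono this

noncomputable def degV (σ k L : Type*) [Field k] [Field L] [Algebra (MvPolynomial σ k) L]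
    [IsFractionRing (MvPolynomial σ k) L] : Valuation L (WithZero (Multiplicative ℤ)) :=
  (degVal σ k).extendToLocalization degVal_supp L

section
variable {σ k L : Type*} [Field k] [Field L] [Algebra (MvPolynomial σ k) L]
    [IsFractionRing (MvPolynomial σ k) L]

theorem degV_algebraMap (p : MvPolynomial σ k) :
    degV σ k L (algebraMap _ L p) = degVal σ k p :=
  Valuation.extendToLocalization_apply_map_apply _ _ _ _

theorem degV_dvr [Nonempty σ] : IsDiscreteValuationRing (degV σ k L).valuationSubring := by
  have : (degV σ k L).IsNontrivial := by
    obtain ⟨i⟩ := ‹Nonempty σ›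
    refine ⟨algebraMap (MvPolynomial σ k) L (MvPolynomial.X i), ?_, ?_⟩
    · rw [degV_algebraMap, degVal_apply (MvPolynomial.X_ne_zero i)]; simp
    · rw [degV_algebraMap, degVal_apply (MvPolynomial.X_ne_zero i)]; simp
  infer_instance
end

theorem D_poly {σ k K : Type*} [Fintype σ] [Field k] [Field K] [Algebra k K]
    [Algebra (MvPolynomial σ k) K] [IsScalarTower k (MvPolynomial σ k) K]
    (D : Derivation k K K) (p : MvPolynomial σ k) :
    D (algebraMap _ K p) = ∑ i, algebraMap _ K (MvPolynomial.pderiv i p) *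
      D (algebraMap (MvPolynomial σ k) K (MvPolynomial.X i)) := by
  classical
  let D1 : Derivation k (MvPolynomial σ k) K := D.compAlgebraMap (MvPolynomial σ k)
  let D2 : Derivation k (MvPolynomial σ k) K := ∑ i,
    (LinearMap.toSpanSingleton (MvPolynomial σ k) K
      (D (algebraMap (MvPolynomial σ k) K (MvPolynomial.X i)))).compDer (MvPolynomial.pderiv i)
  have hsum : ∀ q, D2 q = ∑ i, algebraMap _ K (MvPolynomial.pderiv i q) *
      D (algebraMap (MvPolynomial σ k) K (MvPolynomial.X i)) := by
    intro q
    have hs : D2 q = ∑ i, ((LinearMap.toSpanSingleton (MvPolynomial σ k) K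
      (D (algebraMap (MvPolynomial σ k) K (MvPolynomial.X i)))).compDer
        (MvPolynomial.pderiv i)) q := by
      change Derivation.coeFnAddMonoidHom D2 q = _
      rw [map_sum, Finset.sum_apply]
      rfl
    rw [hs]
    refine Finset.sum_congr rfl fun i _ => ?_
    simp [Algebra.smul_def]
  have h : D1 = D2 := by
    refine MvPolynomial.derivation_ext fun i => ?_
    rw [hsum, Finset.sum_eq_single i]
    · simp [D1]
    · intro j _ hj
      simp [MvPolynomial.pderiv_X_of_ne hj.symm]
    · simp
  rw [← hsum, ← h]
  rfl

theorem bounded_coords {L K Γ ι : Type*} [Field L] [Field K] [Algebra L K] [Fintype ι]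
    [LinearOrderedCommGroupWithZero Γ] (v : Valuation L Γ) (b : Module.Basis ι L K)
    (M : Submodule v.valuationSubring K) (hM : M.FG) :
    ∃ γ : Γ, ∀ m ∈ M, ∀ i, v (b.repr m i) ≤ γ := by
  classical
  obtain ⟨T, rfl⟩ := hM
  refine ⟨T.sup fun t => Finset.univ.sup fun i => v (b.repr t i), fun m hm i => ?_⟩
  induction hm using Submodule.span_induction with
  | mem x hx =>
    exact (Finset.le_sup (f := fun i => v (b.repr x i)) (Finset.mem_univ i)).trans
      (Finset.le_sup (f := fun t => Finset.univ.sup fun i => v (b.repr t i)) hx)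
  | zero => simp
  | add x y _ _ hx hy =>
    simp only [map_add, Finsupp.add_apply]
    exact v.map_add_le hx hy
  | smul r x _ hx =>
    have : r • x = (r : L) • x := rfl
    rw [this, map_smul, Finsupp.smul_apply, smul_eq_mul, map_mul]
    exact (mul_le_mul' ((v.mem_valuationSubring_iff _).mp r.2) hx).trans (by simp)

theorem core {σ k A L K : Type*} [Fintype σ] [Nonempty σ] [Field k] [CharZero k]
    [CommRing A] [IsDomain A]
    [Algebra k A] [Algebra (MvPolynomial σ k) A] [IsScalarTower k (MvPolynomial σ k) A]
    [Module.Finite (MvPolynomial σ k) A]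
    [Field L] [Algebra (MvPolynomial σ k) L] [IsFractionRing (MvPolynomial σ k) L]
    [Field K] [Algebra A K] [IsFractionRing A K] [Algebra (MvPolynomial σ k) K]
    [IsScalarTower (MvPolynomial σ k) A K] [Algebra L K] [IsScalarTower (MvPolynomial σ k) L K]
    [FiniteDimensional L K] [Algebra k K] [IsScalarTower k A K]
    [Algebra k L] [IsScalarTower k (MvPolynomial σ k) L] [IsScalarTower k L K]
    [IsScalarTower k (MvPolynomial σ k) K]
    (δ : Derivation k A A) :
    ∃ W : Submodule k A, FiniteDimensional k W ∧
      ∀ f g : A, f ≠ 0 → δ f = f * g → g ∈ W := by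
  classical
  obtain ⟨D, hD⟩ := exists_derivation_extend k A K δ
  let v := degV σ k L
  let R := v.valuationSubring
  have : IsDiscreteValuationRing R := degV_dvr
  have : CharZero L := charZero_of_injective_algebraMap (algebraMap k L).injective
  let X : σ → K := fun i => D (algebraMap (MvPolynomial σ k) K (MvPolynomial.X i))
  let N : Submodule R K := Submodule.span R (Set.range X)
  have hN : N.FG := Submodule.fg_span (Set.finite_range X)
  have key : ∀ p q : MvPolynomial σ k, q ≠ 0 → degVal σ k p ≤ degVal σ k q →
      D (algebraMap _ K p) / algebraMap _ K q ∈ N := by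
    intro p q hq hpq
    rw [D_poly, Finset.sum_div]
    refine sum_mem fun i _ => ?_
    let r : L := algebraMap _ L (MvPolynomial.pderiv i p) / algebraMap _ L q
    have hr : r ∈ R := by
      rw [Valuation.mem_valuationSubring_iff, map_div₀]
      simp only [v, degV_algebraMap]
      refine div_le_one_of_le₀ ((degVal_pderiv i p).trans hpq) (by simp)
    have : algebraMap _ K (MvPolynomial.pderiv i p) * X i / algebraMap _ K q
        = (⟨r, hr⟩ : R) • X i := by
      change _ = r • X i
      rw [Algebra.smul_def, map_div₀, ← IsScalarTower.algebraMap_apply,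
        ← IsScalarTower.algebraMap_apply]
      ring
    change algebraMap _ K (MvPolynomial.pderiv i p) * X i / algebraMap _ K q ∈ N
    rw [this]
    exact N.smul_mem _ (Submodule.subset_span ⟨i, rfl⟩)
  have hDN : ∀ r : R, D (algebraMap R K r) ∈ N := by
    intro r
    obtain ⟨p, q, hq, hpq⟩ := IsFractionRing.div_surjective (A := MvPolynomial σ k) (r : L)
    have hq0 : q ≠ 0 := nonZeroDivisors.ne_zero hq
    have hqL : algebraMap _ L q ≠ 0 := by simpa using hq0
    have hqK : algebraMap _ K q ≠ 0 := by
      rw [IsScalarTower.algebraMap_apply _ L K]; simpa using hq0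
    have hrK : algebraMap R K r = algebraMap _ K p / algebraMap _ K q := by
      change algebraMap L K (r : L) = _
      rw [← hpq, map_div₀, ← IsScalarTower.algebraMap_apply, ← IsScalarTower.algebraMap_apply]
    have hle : degVal σ k p ≤ degVal σ k q := by
      have h := (v.mem_valuationSubring_iff _).mp r.2
      rw [← hpq, map_div₀] at h
      simp only [v, degV_algebraMap] at h
      refine (div_le_one₀ ?_).mp h
      rw [degVal_apply hq0]; simp
    have e : D (algebraMap R K r) = D (algebraMap _ K p) / algebraMap _ K q
        - r • (D (algebraMap _ K q) / algebraMap _ K q) := by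
      rw [Algebra.smul_def, hrK, Derivation.leibniz_div]
      simp only [smul_eq_mul]
      field_simp
    rw [e]
    exact sub_mem (key p q hq0 hle) (N.smul_mem _ (key q q hq0 le_rfl))
  obtain ⟨M, hM, hlog⟩ := log_bound (L := L) D N hN hDN
  let b := Module.finBasis L K
  obtain ⟨γ, hγ⟩ := bounded_coords v b M hM
  obtain ⟨T, hT⟩ := Module.finite_def.mp ‹Module.Finite (MvPolynomial σ k) A›
  obtain ⟨d, hd⟩ := IsLocalization.exist_integer_multiples_of_finite
    (nonZeroDivisors (MvPolynomial σ k)) (S := L)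
    (fun x : T × Fin (Module.finrank L K) => b.repr (algebraMap A K x.1) x.2)
  have hA : ∀ a : A, ∀ i, IsLocalization.IsInteger (MvPolynomial σ k)
      ((d : MvPolynomial σ k) • b.repr (algebraMap A K a) i) := by
    intro a i
    have ha : a ∈ Submodule.span (MvPolynomial σ k) (T : Set A) := hT ▸ Submodule.mem_top
    induction ha using Submodule.span_induction with
    | mem x hx => exact hd (⟨x, hx⟩, i)
    | zero => simpa using IsLocalization.isInteger_zero
    | add x y _ _ hx hy =>
      simp only [map_add, Finsupp.add_apply, smul_add]
      exact IsLocalization.isInteger_add hx hy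
    | smul r x _ hx =>
      have : algebraMap A K (r • x) = (algebraMap _ L r) • algebraMap A K x := by
        rw [Algebra.smul_def, map_mul, Algebra.smul_def, ← IsScalarTower.algebraMap_apply,
          ← IsScalarTower.algebraMap_apply]
      rw [this, map_smul, Finsupp.smul_apply, algebraMap_smul, smul_comm]
      exact IsLocalization.isInteger_smul hx
  obtain ⟨n, hn⟩ : ∃ n : ℕ, degVal σ k d * γ ≤ WithZero.exp (n : ℤ) := by
    rcases eq_or_ne (degVal σ k d * γ) 0 with h | h
    · exact ⟨0, by rw [h]; simp⟩
    · refine ⟨(WithZero.log (degVal σ k d * γ)).toNat, ?_⟩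
      rw [← WithZero.log_le_iff_le_exp h]
      exact Int.self_le_toNat _
  let Y : Submodule k L := (MvPolynomial.restrictTotalDegree σ k n).map
    (IsScalarTower.toAlgHom k (MvPolynomial σ k) L).toLinearMap
  have : Module.Finite k Y := inferInstance
  let φ : A →ₗ[k] (Fin (Module.finrank L K) → L) :=
    LinearMap.pi fun i => (LinearMap.mulLeft k (algebraMap _ L (d : MvPolynomial σ k))) ∘ₗ
      ((b.coord i).restrictScalars k) ∘ₗ (IsScalarTower.toAlgHom k A K).toLinearMap
  have hφ : ∀ a i, φ a i = (d : MvPolynomial σ k) • b.repr (algebraMap A K a) i := by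
    intro a i
    simp [φ, Algebra.smul_def]
  have hinj : Function.Injective φ := by
    intro x y hxy
    apply IsFractionRing.injective A K
    apply b.repr.injective
    ext i
    have h := congrFun hxy i
    rw [hφ, hφ, Algebra.smul_def, Algebra.smul_def] at h
    exact mul_left_cancel₀ (by simp) h
  let W : Submodule k A := (Submodule.pi Set.univ fun _ => Y).comap φ
  refine ⟨W, ?_, ?_⟩
  · let ψ : W →ₗ[k] (Fin (Module.finrank L K) → Y) :=
      LinearMap.pi fun i => ((LinearMap.proj i ∘ₗ φ) ∘ₗ W.subtype).codRestrict Y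
        (fun w => w.2 i (Set.mem_univ i))
    refine FiniteDimensional.of_injective ψ ?_
    intro x y hxy
    apply Subtype.ext
    apply hinj
    ext i
    exact congrArg Subtype.val (congrFun hxy i)
  · intro f g hf hfg i _
    have hfK : algebraMap A K f ≠ 0 := by simpa using hf
    have h1 := hlog _ hfK
    rw [hD, hfg, map_mul, mul_div_cancel_left₀ _ hfK] at h1
    have h2 := hγ _ h1 i
    obtain ⟨p, hp⟩ := hA g i
    rw [hφ, ← hp]
    refine ⟨p, ?_, rfl⟩
    change p ∈ MvPolynomial.restrictTotalDegree σ k n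
    rw [MvPolynomial.mem_restrictTotalDegree]
    by_cases hp0 : p = 0
    · simp [hp0]
    have h3 : degVal σ k p ≤ WithZero.exp (n : ℤ) := by
      rw [← degV_algebraMap (L := L), hp, Algebra.smul_def, map_mul, degV_algebraMap]
      exact (mul_le_mul_right h2 _).trans hn
    rw [degVal_apply hp0, WithZero.exp_le_exp] at h3
    exact_mod_cast h3

/-- Let `k` be a field of characteristic zero and `A` a finitely
generated integrally closed `k`-algebra that is an integral domain, with a `k`-linear
derivation `δ`.  Then there is a finite-dimensional `k`-subspace `W` of `A` such that for
every nonzero `f ∈ A` with `δ f / f ∈ A` (i.e. `δ f = f * g` for some `g ∈ A`), one has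
`δ f / f ∈ W` (i.e. `g ∈ W`). -/
theorem exists_bounding_subspace_for_logarithmic_derivatives
    (k A : Type*) [Field k] [CharZero k] [CommRing A] [IsDomain A]
    [Algebra k A] [IsIntegrallyClosed A]
    (hfg : Algebra.FiniteType k A) (δ : Derivation k A A) :
    ∃ W : Submodule k A, FiniteDimensional k W ∧
      ∀ f g : A, f ≠ 0 → δ f = f * g → g ∈ W := by
  obtain ⟨s, φ, hinj, hfin⟩ := exists_finite_inj_algHom_of_fg k A
  let : Algebra (MvPolynomial (Fin s) k) A := φ.toRingHom.toAlgebra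
  have : IsScalarTower k (MvPolynomial (Fin s) k) A :=
    IsScalarTower.of_algebraMap_eq fun x => (φ.commutes x).symm
  have : Module.Finite (MvPolynomial (Fin s) k) A := hfin
  have : FaithfulSMul (MvPolynomial (Fin s) k) A :=
    (faithfulSMul_iff_algebraMap_injective _ _).mpr hinj
  rcases Nat.eq_zero_or_pos s with rfl | hs
  · have : Module.Finite k (MvPolynomial (Fin 0) k) :=
      Module.Finite.equiv (MvPolynomial.isEmptyAlgEquiv k (Fin 0)).symm.toLinearEquiv
    have : Module.Finite k A := Module.Finite.trans (MvPolynomial (Fin 0) k) A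
    exact ⟨⊤, inferInstance, fun _ _ _ _ => Submodule.mem_top⟩
  · have : Nonempty (Fin s) := ⟨⟨0, hs⟩⟩
    let L := FractionRing (MvPolynomial (Fin s) k)
    let K := FractionRing A
    let : Algebra L K := FractionRing.liftAlgebra (MvPolynomial (Fin s) k) K
    have : IsScalarTower (MvPolynomial (Fin s) k) L K :=
      FractionRing.isScalarTower_liftAlgebra _ _
    have : FiniteDimensional L K :=
      Module.Finite.of_isLocalization (MvPolynomial (Fin s) k) A
        (nonZeroDivisors (MvPolynomial (Fin s) k))
    have : IsScalarTower k L K := by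
      refine IsScalarTower.of_algebraMap_eq fun x => ?_
      rw [IsScalarTower.algebraMap_apply k (MvPolynomial (Fin s) k) L,
        ← IsScalarTower.algebraMap_apply (MvPolynomial (Fin s) k) L K,
        ← IsScalarTower.algebraMap_apply k (MvPolynomial (Fin s) k) K]
    exact core (σ := Fin s) (L := L) (K := K) δ
end

section
/- Let N ≥ 1 and d ≥ 1 be integers, and suppose X ⊆ ℂ^d is the common zero set of a family of polynomials in ℂ[x1,...,xd], each of total degree at most N. Then the number of zero-dimensional irreducible components of X — that is, the number of points p ∈ X such that the singleton {p} is an irreducible component of X in the Zariski topology — is at most N^{d+1}. -/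
/-- The Zariski topology on `ℂ^d`: closed sets are the common zero sets of collections of
polynomials; it is generated by the basic open sets `{p | f p ≠ 0}`. -/
def zariskiTopology (d : ℕ) : TopologicalSpace (Fin d → ℂ) :=
  TopologicalSpace.generateFrom
    {U : Set (Fin d → ℂ) | ∃ f : MvPolynomial (Fin d) ℂ, U = {p | MvPolynomial.eval p f ≠ 0}}

open MvPolynomial

/-- All maximal ideals of a polynomial ring over a Noetherian Jacobson ring, all of whose maximal
ideals have height `h`, have height `h + n`. -/
lemma bz_height_maximal {R : Type} [CommRing R] [IsNoetherianRing R] [IsJacobsonRing R] (h : ℕ∞)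
    (hR : ∀ m : Ideal R, m.IsMaximal → m.height = h) (n : ℕ) :
    ∀ M : Ideal (MvPolynomial (Fin n) R), M.IsMaximal → M.height = h + n := by
  induction n with
  | zero =>
    intro M hM
    let e := (isEmptyAlgEquiv R (Fin 0)).toRingEquiv
    have h1 := e.height_map M
    have : (M.map e).IsMaximal := Ideal.map_isMaximal_of_equiv e
    rw [← h1, hR _ this]
    simp
  | succ n ih =>
    intro M hM
    let e := (finSuccEquiv R n).toRingEquiv
    have h1 := e.height_map M
    have : (M.map e).IsMaximal := Ideal.map_isMaximal_of_equiv e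
    rw [← h1]
    have h3 : ∀ M' : Ideal (Polynomial (MvPolynomial (Fin n) R)), M'.IsMaximal →
        M'.height = h + n + 1 := by
      intro M' hM'
      have h2 : (M'.under (MvPolynomial (Fin n) R)).IsMaximal :=
        Polynomial.isMaximal_comap_C_of_isJacobsonRing M'
      have h4 : M'.LiesOver (M'.under (MvPolynomial (Fin n) R)) := ⟨rfl⟩
      rw [Polynomial.height_eq_height_add_one (M'.under (MvPolynomial (Fin n) R)) M', ih _ h2]
    rw [h3 _ this]
    push_cast
    rw [add_assoc]

lemma bz_height_field (d : ℕ) (M : Ideal (MvPolynomial (Fin d) ℂ)) (hM : M.IsMaximal) :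
    M.height = d := by
  have := bz_height_maximal (R := ℂ) 0 (fun m hm => by
    rw [Ideal.eq_bot_of_prime m, Ideal.height_bot]) d M hM
  simpa using this

lemma bz_height_poly (d : ℕ) (M : Ideal (MvPolynomial (Fin d) (Polynomial ℂ)))
    (hM : M.IsMaximal) : M.height = d + 1 := by
  have := bz_height_maximal (R := Polynomial ℂ) 1 (fun m hm =>
    IsPrincipalIdealRing.height_eq_one_of_isMaximal m (Polynomial.not_isField ℂ)) d M hM
  rw [this, add_comm]

/-- General position. -/
lemma bz_generic {d : ℕ} (W : Submodule ℂ (MvPolynomial (Fin d) ℂ)) (i : ℕ) :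
    ∃ f : Fin i → MvPolynomial (Fin d) ℂ, (∀ j, f j ∈ W) ∧
      ∀ q : Ideal (MvPolynomial (Fin d) ℂ), q.IsPrime → (∀ j, f j ∈ q) →
        ¬ (W : Set (MvPolynomial (Fin d) ℂ)) ⊆ q → (i : ℕ∞) ≤ q.height := by
  induction i with
  | zero => exact ⟨Fin.elim0, fun j => j.elim0, fun q _ _ _ => by simp⟩
  | succ i ih =>
    obtain ⟨f, hf, hq⟩ := ih
    let I := Ideal.span (Set.range f)
    have hfin : I.minimalPrimes.Finite := Ideal.finite_minimalPrimes_of_isNoetherianRing _ I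
    let T := {q : Ideal (MvPolynomial (Fin d) ℂ) // q ∈ I.minimalPrimes ∧
      ¬ (W : Set (MvPolynomial (Fin d) ℂ)) ⊆ q}
    have : Finite T := (hfin.subset (fun q (hq : _ ∧ _) => hq.1)).to_subtype
    have key : ∃ g ∈ W, ∀ q : T, g ∉ q.1 := by
      by_contra! hcon
      have := Subspace.exists_eq_top_of_iUnion_eq_univ (k := ℂ) (E := W)
        (p := fun q : T => (q.1.restrictScalars ℂ).comap W.subtype) (by
          ext g
          obtain ⟨q, hq⟩ := hcon g g.2
          simp only [Set.mem_iUnion, Set.mem_univ, iff_true]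
          exact ⟨q, hq⟩)
      obtain ⟨q, hq⟩ := this
      apply q.2.2
      intro g hg
      have : (⟨g, hg⟩ : W) ∈ (q.1.restrictScalars ℂ).comap W.subtype := by rw [hq]; trivial
      exact this
    obtain ⟨g, hgW, hg⟩ := key
    refine ⟨Fin.cons g f, fun j => ?_, fun q hqp hfq hWq => ?_⟩
    · refine Fin.cases ?_ (fun j => ?_) j
      · simpa using hgW
      · simpa using hf j
    · have hIq : I ≤ q := by
        rw [Ideal.span_le]
        rintro _ ⟨j, rfl⟩
        simpa using hfq j.succ
      obtain ⟨q', hq', hle⟩ := Ideal.exists_minimalPrimes_le hIq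
      have hq'p : q'.IsPrime := hq'.1.1
      have hWq' : ¬ (W : Set (MvPolynomial (Fin d) ℂ)) ⊆ q' := fun h => hWq (h.trans hle)
      have hgq : g ∈ q := by simpa using hfq 0
      have hlt : q' < q := lt_of_le_of_ne hle (by
        rintro rfl
        exact hg ⟨q', hq', hWq'⟩ hgq)
      have h1 := hq q' hq'p (fun j => hq'.1.2 (Ideal.subset_span ⟨j, rfl⟩)) hWq'
      calc ((i + 1 : ℕ) : ℕ∞) = i + 1 := by push_cast; rfl
        _ ≤ q'.height + 1 := by gcongr
        _ ≤ q.height := Ideal.height_add_one_le_of_lt_of_isPrime hlt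

/-- The homotopy. -/
noncomputable def bzHom {d : ℕ} (N : ℕ) (f : Fin d → MvPolynomial (Fin d) ℂ) (i : Fin d) :
    MvPolynomial (Fin d) (Polynomial ℂ) :=
  C (1 - Polynomial.X) * X i ^ N + C Polynomial.X * map Polynomial.C (f i)

lemma bz_krull {d : ℕ} (N : ℕ) (f : Fin d → MvPolynomial (Fin d) ℂ) (p : Fin d → ℂ)
    (hp : ∀ i, eval p (f i) = 0)
    (hiso : ∀ q : Ideal (MvPolynomial (Fin d) ℂ), q.IsPrime → (∀ i, f i ∈ q) →
      q ≤ RingHom.ker (eval p) → RingHom.ker (eval p) ≤ q)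
    (k : ℕ) (G : MvPolynomial (Fin d) (Polynomial ℂ))
    (hG : C ((Polynomial.X - 1) ^ k) * G ∈ Ideal.span (Set.range (bzHom N f))) :
    eval₂ (Polynomial.evalRingHom 1) p G = 0 := by
  by_contra hne
  let ψ : MvPolynomial (Fin d) (Polynomial ℂ) →+* ℂ := eval₂Hom (Polynomial.evalRingHom 1) p
  have hψs : Function.Surjective ψ := fun c => ⟨C (Polynomial.C c), by simp [ψ]⟩
  have hmax : (RingHom.ker ψ).IsMaximal := RingHom.ker_isMaximal_of_surjective ψ hψs
  let ι : MvPolynomial (Fin d) ℂ →+* MvPolynomial (Fin d) (Polynomial ℂ) := map Polynomial.C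
  let ρ : MvPolynomial (Fin d) (Polynomial ℂ) →+* MvPolynomial (Fin d) ℂ :=
    map (Polynomial.evalRingHom 1)
  have hψι : ψ.comp ι = eval p := by
    apply MvPolynomial.ringHom_ext <;> intros <;> simp [ψ, ι]
  have hψρ : (eval p).comp ρ = ψ := by
    apply MvPolynomial.ringHom_ext <;> intros <;> simp [ψ, ρ]
  have hmin : RingHom.ker ψ ∈ (Ideal.span (Set.range (bzHom N f))).minimalPrimes := by
    refine ⟨⟨hmax.isPrime, ?_⟩, ?_⟩
    · rw [Ideal.span_le]
      rintro _ ⟨i, rfl⟩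
      have := DFunLike.congr_fun hψι (f i)
      simp only [RingHom.comp_apply, hp i] at this
      simp only [SetLike.mem_coe, RingHom.mem_ker, bzHom, map_add, map_mul]
      change _ + _ * ψ (ι (f i)) = 0
      rw [this]
      simp [ψ]
    · rintro Q ⟨hQp, hQ⟩ hle g hg
      have hX : C (Polynomial.X - 1) ∈ Q := by
        have h1 := hQ hG
        rcases hQp.mem_or_mem h1 with h2 | h2
        · rw [map_pow] at h2
          exact hQp.mem_of_pow_mem _ h2
        · exact absurd (hle h2) hne
      have hq := hiso (Q.comap ι) (Ideal.comap_isPrime ι Q) (fun i => by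
        rw [Ideal.mem_comap]
        have h1 : bzHom N f i ∈ Q := hQ (Ideal.subset_span ⟨i, rfl⟩)
        have h2 : ι (f i) = bzHom N f i + C (Polynomial.X - 1) * (X i ^ N - ι (f i)) := by
          simp only [bzHom, ι, map_sub, map_one]; ring
        rw [h2]
        exact Q.add_mem h1 (Q.mul_mem_right _ hX)) (fun a ha => by
        have := hle ha
        rw [RingHom.mem_ker] at this ⊢
        rw [← hψι]; exact this)
      have h3 : (Ideal.Quotient.mk Q).comp (ι.comp ρ) = Ideal.Quotient.mk Q := by
        have hX' : Ideal.Quotient.mk Q (C Polynomial.X) = 1 := by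
          rw [← sub_eq_zero, ← map_one (Ideal.Quotient.mk Q), ← map_sub,
            Ideal.Quotient.eq_zero_iff_mem]
          simpa using hX
        apply MvPolynomial.ringHom_ext
        · intro r
          suffices h : ((Ideal.Quotient.mk Q).comp (ι.comp ρ)).comp C =
              (Ideal.Quotient.mk Q).comp C from DFunLike.congr_fun h r
          apply Polynomial.ringHom_ext
          · intro a; simp [ι, ρ]
          · simp [ι, ρ, hX']
        · intro i; simp [ι, ρ]
      have h4 : ρ g ∈ RingHom.ker (eval p) := by
        rw [RingHom.mem_ker] at hg ⊢
        rw [← hg, ← hψρ]; rfl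
      have h5 : ι (ρ g) ∈ Q := hq h4
      rw [← Ideal.Quotient.eq_zero_iff_mem] at h5 ⊢
      rw [← h5]
      exact (DFunLike.congr_fun h3 g).symm
  have h1 := Ideal.height_le_card_of_mem_minimalPrimes_span (Set.finite_range _) hmin
  rw [bz_height_poly d _ hmax] at h1
  have h2 : (Set.range (bzHom N f)).ncard ≤ d := by
    have := Set.ncard_image_le (f := bzHom N f) (Set.finite_univ (α := Fin d))
    rwa [Set.image_univ, Set.ncard_univ, Nat.card_fin] at this
  have h3 : d + 1 ≤ (Set.range (bzHom N f)).ncard := by exact_mod_cast h1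
  omega

lemma bz_totalDegree_map {d : ℕ} (g : MvPolynomial (Fin d) ℂ) :
    (map (Polynomial.C : ℂ →+* Polynomial ℂ) g).totalDegree ≤ g.totalDegree :=
  Finset.sup_mono (support_map_subset _ _)

/-- reduced monomials -/
noncomputable def bzMon (d N : ℕ) (a : Fin d → Fin N) : MvPolynomial (Fin d) (Polynomial ℂ) :=
  monomial (Finsupp.equivFunOnFinite.symm fun i => (a i : ℕ)) 1

open scoped Pointwise in
lemma bz_nakayama {d : ℕ} (N : ℕ) (f : Fin d → MvPolynomial (Fin d) ℂ)
    (hf : ∀ i, (f i).totalDegree ≤ N) (D : ℕ) :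
    ∃ h : Polynomial ℂ, h ≠ 0 ∧ ∀ g ∈ restrictTotalDegree (Fin d) (Polynomial ℂ) D,
      ∃ c : (Fin d → Fin N) → Polynomial ℂ,
        h • g - ∑ a, c a • bzMon d N a ∈ Ideal.span (Set.range (bzHom N f)) := by
  set J := Ideal.span (Set.range (bzHom N f)) with hJ
  let P := restrictTotalDegree (Fin d) (Polynomial ℂ) D
  let Red := Submodule.span (Polynomial ℂ) (Set.range (bzMon d N))
  have hfg : P.FG := Module.Finite.iff_fg.mp inferInstance
  have hle : P ≤ (Red ⊔ J.restrictScalars (Polynomial ℂ)) ⊔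
      (Ideal.span {(Polynomial.X : Polynomial ℂ)}) • P := by
    intro g hg
    have hgD : g.totalDegree ≤ D := (mem_restrictTotalDegree _ _ _).mp hg
    rw [g.as_sum]
    refine Submodule.sum_mem _ fun s hs => ?_
    have hsD : (s.sum fun _ e => e) ≤ D := (le_totalDegree hs).trans hgD
    have hmon : monomial s (coeff s g) = (coeff s g) • monomial s (1 : Polynomial ℂ) := by
      simp [smul_monomial]
    rw [hmon]
    refine Submodule.smul_mem _ _ ?_
    by_cases hsN : ∀ i, s i < N
    · refine Submodule.mem_sup_left (Submodule.mem_sup_left (Submodule.subset_span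
        ⟨fun i => ⟨s i, hsN i⟩, ?_⟩))
      unfold bzMon
      congr 1
      ext i
      simp
    · push Not at hsN
      obtain ⟨i, hi⟩ := hsN
      let s' := s - Finsupp.single i N
      have hss : s' + Finsupp.single i N = s := tsub_add_cancel_of_le (by simpa using hi)
      let w : MvPolynomial (Fin d) (Polynomial ℂ) := monomial s' 1
      have hw : monomial s (1 : Polynomial ℂ) = w * X i ^ N := by
        rw [X_pow_eq_monomial, monomial_mul, hss, one_mul]
      have hsum : (s'.sum fun _ e => e) + N ≤ D := by
        rw [← hss, Finsupp.sum_add_index' (by simp) (by simp), Finsupp.sum_single_index rfl] at hsD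
        exact hsD
      have hdw : w.totalDegree ≤ s'.sum fun _ e => e := totalDegree_monomial_le _ _
      have heq : w * X i ^ N = w * bzHom N f i +
          (Polynomial.X : Polynomial ℂ) • (w * (X i ^ N - map Polynomial.C (f i))) := by
        rw [smul_eq_C_mul, bzHom, map_sub, map_one]; ring
      rw [hw, heq]
      refine Submodule.add_mem_sup (Submodule.mem_sup_right ?_) ?_
      · exact J.mul_mem_left _ (Ideal.subset_span ⟨i, rfl⟩)
      · refine Submodule.smul_mem_smul (Ideal.mem_span_singleton_self _) ?_
        rw [mem_restrictTotalDegree]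
        refine (totalDegree_mul _ _).trans ?_
        have h1 : (X i ^ N - map Polynomial.C (f i) :
            MvPolynomial (Fin d) (Polynomial ℂ)).totalDegree ≤ N := by
          refine (totalDegree_sub _ _).trans (max_le ?_ ?_)
          · rw [totalDegree_X_pow]
          · exact (bz_totalDegree_map _).trans (hf i)
        omega
  obtain ⟨h, h1, h2⟩ := Submodule.exists_sub_one_mem_and_smul_le_of_fg_of_le_sup hfg le_rfl hle
  refine ⟨h, ?_, fun g hg => ?_⟩
  · rintro rfl
    rw [Ideal.mem_span_singleton, Polynomial.X_dvd_iff] at h1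
    simp at h1
  · have h3 := h2 (Submodule.smul_mem_pointwise_smul g h P hg)
    obtain ⟨r, hr, j, hj, hrj⟩ := Submodule.mem_sup.mp h3
    obtain ⟨c, hc⟩ := (Submodule.mem_span_range_iff_exists_fun _).mp hr
    refine ⟨c, ?_⟩
    rw [hc, ← hrj, add_sub_cancel_left]
    exact hj

lemma bz_interp {d : ℕ} (T : Finset (Fin d → ℂ)) (p : Fin d → ℂ) :
    ∃ L : MvPolynomial (Fin d) ℂ, eval p L ≠ 0 ∧ ∀ q ∈ T, q ≠ p → eval q L = 0 := by
  classical
  have h1 : ∀ q : Fin d → ℂ, ∃ l : MvPolynomial (Fin d) ℂ, q ≠ p → eval p l ≠ 0 ∧ eval q l = 0 := by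
    intro q
    by_cases hq : q = p
    · exact ⟨0, fun h => absurd hq h⟩
    · obtain ⟨i, hi⟩ := Function.ne_iff.mp hq
      exact ⟨X i - C (q i), fun _ => ⟨by simpa [sub_eq_zero] using fun h => hi h.symm, by simp⟩⟩
  choose l hl using h1
  refine ⟨∏ q ∈ T.erase p, l q, ?_, fun q hq hqp => ?_⟩
  · rw [map_prod, Finset.prod_ne_zero_iff]
    exact fun q hq => (hl q (Finset.ne_of_mem_erase hq)).1
  · rw [map_prod]
    exact Finset.prod_eq_zero (Finset.mem_erase.mpr ⟨hqp, hq⟩) (hl q hqp).2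

lemma bz_count {d : ℕ} (N : ℕ) (f : Fin d → MvPolynomial (Fin d) ℂ)
    (hf : ∀ i, (f i).totalDegree ≤ N) (T : Finset (Fin d → ℂ))
    (hp : ∀ p ∈ T, ∀ i, eval p (f i) = 0)
    (hiso : ∀ p ∈ T, ∀ q : Ideal (MvPolynomial (Fin d) ℂ), q.IsPrime → (∀ i, f i ∈ q) →
      q ≤ RingHom.ker (eval p) → RingHom.ker (eval p) ≤ q) :
    T.card ≤ N ^ d := by
  classical
  by_contra! hcard
  choose L hL1 hL2 using bz_interp T
  obtain ⟨h, hh, hred⟩ := bz_nakayama N f hf (T.sup fun p => (L p).totalDegree)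
  have hred' : ∀ p : T, ∃ c : (Fin d → Fin N) → Polynomial ℂ,
      h • map Polynomial.C (L p) - ∑ a, c a • bzMon d N a ∈
        Ideal.span (Set.range (bzHom N f)) := fun p => hred _ (by
    rw [mem_restrictTotalDegree]
    exact (bz_totalDegree_map _).trans (Finset.le_sup (f := fun p => (L p).totalDegree) p.2))
  choose c hc using hred'
  have hdep : ¬ LinearIndependent (Polynomial ℂ) c := by
    intro hli
    have := hli.fintype_card_le_finrank
    rw [Module.finrank_fintype_fun_eq_card] at this
    simp at this
    omega
  obtain ⟨b, hb, p₀, hp₀⟩ := Fintype.not_linearIndependent_iff.mp hdep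
  let B : T → Polynomial ℂ := fun p => b p * h
  have hBJ : ∑ p, B p • map Polynomial.C (L p) ∈ Ideal.span (Set.range (bzHom N f)) := by
    have h1 : ∑ p : T, b p • (h • map Polynomial.C (L p) - ∑ a, c p a • bzMon d N a) ∈
        Ideal.span (Set.range (bzHom N f)) :=
      Submodule.sum_mem _ fun p _ => by
        rw [smul_eq_C_mul]; exact Ideal.mul_mem_left _ _ (hc p)
    convert h1 using 1
    simp only [smul_sub, Finset.sum_sub_distrib, Finset.smul_sum, smul_smul]
    rw [Finset.sum_comm]
    have h2 : ∀ a, ∑ p, (b p * c p a) • bzMon d N a = 0 := fun a => by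
      rw [← Finset.sum_smul]
      have := congr_fun hb a
      simp only [Finset.sum_apply, Pi.smul_apply, smul_eq_mul, Pi.zero_apply] at this
      rw [this, zero_smul]
    simp only [h2, Finset.sum_const_zero, sub_zero, B]
  obtain ⟨B', hB', hgcd⟩ := Finset.extract_gcd B (s := Finset.univ) ⟨p₀, Finset.mem_univ _⟩
  set g := Finset.univ.gcd B with hg
  have hg0 : g ≠ 0 := by
    intro h0
    have := hB' p₀ (Finset.mem_univ _)
    rw [h0, zero_mul] at this
    exact mul_ne_zero hp₀ hh this
  obtain ⟨g', hg', hndvd⟩ := Polynomial.exists_eq_pow_rootMultiplicity_mul_and_not_dvd g hg0 1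
  have hex : ∃ p : T, (B' p).eval 1 ≠ 0 := by
    by_contra! hall
    have : (Polynomial.X - Polynomial.C (1 : ℂ)) ∣ Finset.univ.gcd B' :=
      Finset.dvd_gcd fun p _ => Polynomial.dvd_iff_isRoot.mpr (hall p)
    rw [hgcd] at this
    exact Polynomial.not_isUnit_X_sub_C (1 : ℂ) (isUnit_of_dvd_one this)
  obtain ⟨p, hpB⟩ := hex
  have := bz_krull N f p (hp p p.2) (hiso p p.2) (g.rootMultiplicity 1)
    (∑ q : T, C (g' * B' q) * map Polynomial.C (L q)) (by
      convert hBJ using 1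
      rw [Finset.mul_sum]
      refine Finset.sum_congr rfl fun q _ => ?_
      rw [smul_eq_C_mul, hB' q (Finset.mem_univ _), ← mul_assoc, ← map_mul, ← mul_assoc]
      conv_rhs => rw [hg']
      simp)
  rw [eval₂_sum, Finset.sum_eq_single p] at this
  · simp only [eval₂_mul, eval₂_C, eval₂_map, map_mul] at this
    have h1 : (Polynomial.evalRingHom (1 : ℂ)).comp Polynomial.C = RingHom.id ℂ := by
      ext <;> simp
    rw [h1] at this
    have h2 : g'.eval 1 ≠ 0 := fun h => hndvd (Polynomial.dvd_iff_isRoot.mpr h)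
    exact mul_ne_zero (mul_ne_zero h2 hpB) (hL1 p) this
  · intro q _ hqp
    have h1 : (Polynomial.evalRingHom (1 : ℂ)).comp Polynomial.C = RingHom.id ℂ := by
      ext <;> simp
    rw [eval₂_mul, eval₂_map, h1]
    have h2 : eval₂ (RingHom.id ℂ) p.1 (L q) = 0 :=
      hL2 q p p.2 (fun h => hqp (Subtype.ext h.symm))
    rw [h2, mul_zero]
  · simp

lemma bz_irred {d : ℕ} (q : Ideal (MvPolynomial (Fin d) ℂ)) (hq : q.IsPrime) (p : Fin d → ℂ)
    (hp : p ∈ zeroLocus ℂ q) : @IsIrreducible _ (zariskiTopology d) (zeroLocus ℂ q) := by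
  letI := zariskiTopology d
  have hbasis : TopologicalSpace.IsTopologicalBasis
      {U : Set (Fin d → ℂ) | ∃ f : MvPolynomial (Fin d) ℂ, U = {p | eval p f ≠ 0}} := by
    refine ⟨?_, ?_, rfl⟩
    · rintro _ ⟨f, rfl⟩ _ ⟨g, rfl⟩ x ⟨hx1, hx2⟩
      refine ⟨{p | eval p (f * g) ≠ 0}, ⟨f * g, rfl⟩, ?_, ?_⟩
      · simpa using ⟨hx1, hx2⟩
      · intro y hy
        simpa using hy
    · refine Set.sUnion_eq_univ_iff.mpr fun x => ⟨_, ⟨1, rfl⟩, by simp⟩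
  refine ⟨⟨p, hp⟩, ?_⟩
  rintro U V hU hV ⟨a, haZ, haU⟩ ⟨b, hbZ, hbV⟩
  obtain ⟨_, ⟨f, rfl⟩, haf, hfU⟩ := hbasis.exists_subset_of_mem_open haU hU
  obtain ⟨_, ⟨g, rfl⟩, hbg, hgV⟩ := hbasis.exists_subset_of_mem_open hbV hV
  have hfq : f ∉ q := fun h => haf (haZ f h)
  have hgq : g ∉ q := fun h => hbg (hbZ g h)
  have hfg : f * g ∉ q := fun h => (hq.mem_or_mem h).elim hfq hgq
  rw [← IsPrime.vanishingIdeal_zeroLocus (K := ℂ) q, mem_vanishingIdeal_iff] at hfg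
  push Not at hfg
  obtain ⟨z, hz, hne⟩ := hfg
  have hne' : eval z f * eval z g ≠ 0 := by rw [← map_mul]; exact hne
  exact ⟨z, hz, hfU (left_ne_zero_of_mul hne'), hgV (right_ne_zero_of_mul hne')⟩

/-- Let `N, d ≥ 1` and let `X ⊆ ℂ^d` be the common zero set of a family
`F` of polynomials each of total degree at most `N`.  Then the set of points `p ∈ X` such
that `{p}` is an irreducible component of `X` in the Zariski topology (i.e. `{p}` is
maximal among irreducible subsets of `X`) is finite, of cardinality at most `N ^ (d+1)`. -/
theorem card_zero_dimensional_components_le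
    (N d : ℕ) (hN : 1 ≤ N) (hd : 1 ≤ d)
    (F : Set (MvPolynomial (Fin d) ℂ)) (hF : ∀ f ∈ F, f.totalDegree ≤ N) :
    let X : Set (Fin d → ℂ) := {p | ∀ f ∈ F, MvPolynomial.eval p f = 0}
    let S : Set (Fin d → ℂ) := {p | Maximal
      (fun s : Set (Fin d → ℂ) => s ⊆ X ∧ @IsIrreducible _ (zariskiTopology d) s) {p}}
    S.Finite ∧ S.ncard ≤ N ^ (d + 1) := by
  intro X S
  let W := Submodule.span ℂ F
  obtain ⟨f, hfW, hgen⟩ := bz_generic W d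
  have hWN : W ≤ restrictTotalDegree (Fin d) ℂ N :=
    Submodule.span_le.mpr fun g hg => (mem_restrictTotalDegree _ _ _).mpr (hF g hg)
  have hS : ∀ p ∈ S, Maximal
      (fun s : Set (Fin d → ℂ) => s ⊆ X ∧ @IsIrreducible _ (zariskiTopology d) s) {p} :=
    fun p hp => hp
  have hSX : ∀ p ∈ S, ∀ g ∈ W, g ∈ RingHom.ker (eval p) := by
    intro p hp g hg
    have h1 : p ∈ X := (hS p hp).prop.1 rfl
    have h2 : W ≤ (RingHom.ker (eval p)).restrictScalars ℂ :=
      Submodule.span_le.mpr fun g hg => h1 g hg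
    exact h2 hg
  have hSmin : ∀ p ∈ S, ∀ q : Ideal (MvPolynomial (Fin d) ℂ), q.IsPrime →
      (W : Set (MvPolynomial (Fin d) ℂ)) ⊆ q →
      q ≤ RingHom.ker (eval p) → RingHom.ker (eval p) ≤ q := by
    intro p hp q hq hWq hqp
    have hpZ : p ∈ zeroLocus ℂ q := fun g hg => hqp hg
    have hle := (hS p hp).le_of_ge (y := zeroLocus ℂ q)
      ⟨fun z hz g hg => hz g (hWq (Submodule.subset_span hg)), bz_irred q hq p hpZ⟩
      (Set.singleton_subset_iff.mpr hpZ)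
    rw [← IsPrime.vanishingIdeal_zeroLocus (K := ℂ) q]
    intro g hg x hx
    have : x = p := hle hx
    subst this
    exact hg
  have hbound : ∀ T : Finset (Fin d → ℂ), (T : Set (Fin d → ℂ)) ⊆ S → T.card ≤ N ^ d := by
    intro T hT
    refine bz_count N f (fun i => (mem_restrictTotalDegree _ _ _).mp (hWN (hfW i))) T
      (fun p hp i => hSX p (hT hp) _ (hfW i)) ?_
    intro p hp q hq hfq hqp
    by_cases hWq : (W : Set (MvPolynomial (Fin d) ℂ)) ⊆ q
    · exact hSmin p (hT hp) q hq hWq hqp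
    · have hmax : (RingHom.ker (eval p)).IsMaximal :=
        RingHom.ker_isMaximal_of_surjective _ (fun c => ⟨C c, by simp⟩)
      have := hmax.isPrime
      rcases hqp.eq_or_lt with heq | hlt
      · exact heq.ge
      · have h1 := Ideal.height_add_one_le_of_lt_of_isPrime hlt
        rw [bz_height_field d _ hmax] at h1
        have h2 : (d : ℕ∞) + 1 ≤ d := le_trans (by gcongr; exact hgen q hq hfq hWq) h1
        have h3 : d + 1 ≤ d := by exact_mod_cast h2
        omega
  have hfin : S.Finite := by
    by_contra hinf
    obtain ⟨T, hT, hc⟩ := Set.Infinite.exists_subset_card_eq hinf (N ^ d + 1)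
    have := hbound T hT
    omega
  refine ⟨hfin, ?_⟩
  rw [Set.ncard_eq_toFinset_card S hfin]
  exact (hbound _ (by simp)).trans (Nat.pow_le_pow_right hN (Nat.le_succ d))
end

section
/- Let A be an affine ℂ-algebra (a finitely generated integral domain ℂ-algebra), let L1,...,Lm be ℂ-linear maps from A to A, and let V and W be finite-dimensional ℂ-linear subspaces of A. Let X be the set of nonzero f ∈ V such that for every j = 1,...,m one has L_j(f)/f ∈ W (i.e., L_j(f) ∈ f·W). Then the image of X in the projectivization ℙ(V) — that is, the set of equivalence classes of elements of X under the relation f ~ λf for λ ∈ ℂ^× — is either uncountable or has cardinality at most (dim_ℂ V)^{2 + m·dim_ℂ W}. -/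
namespace PB

open MvPolynomial in
lemma mv_height (ι : Type) [Finite ι] :
    ∀ (P : Ideal (MvPolynomial ι ℂ)) [P.IsMaximal], (Nat.card ι : ℕ∞) ≤ P.height := by
  induction ι using Finite.induction_empty_option with
  | of_equiv e H =>
    intro P hP
    let f := (renameEquiv ℂ e).toRingEquiv
    have : (Ideal.comap f P).IsMaximal := Ideal.comap_isMaximal_of_equiv f
    rw [← RingEquiv.height_comap f, ← Nat.card_congr e]
    exact H _
  | h_empty => intro P hP; simp
  | h_option IH =>
    rename_i α hα
    intro P hP
    let f := (optionEquivLeft ℂ α).symm.toRingEquiv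
    have h1 : (Ideal.comap f P).IsMaximal := Ideal.comap_isMaximal_of_equiv f
    rw [← RingEquiv.height_comap f]
    have h2 := Polynomial.isMaximal_comap_C_of_isJacobsonRing (Ideal.comap f P)
    have h3 : (Ideal.comap f P).LiesOver (Ideal.comap Polynomial.C (Ideal.comap f P)) := ⟨rfl⟩
    rw [Polynomial.height_eq_height_add_one (Ideal.comap Polynomial.C (Ideal.comap f P))]
    have := IH (Ideal.comap Polynomial.C (Ideal.comap f P))
    rw [Finite.card_option]
    push_cast
    gcongr

open MvPolynomial in
lemma prime_max {σ : Type} [Finite σ] (P : Ideal (MvPolynomial σ ℂ)) [hP : P.IsPrime]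
    (hZ : (zeroLocus ℂ P).Countable) : P.IsMaximal := by
  obtain ⟨s, g, hg, hIntg⟩ := exists_integral_inj_algHom_of_fg ℂ (MvPolynomial σ ℂ ⧸ P)
  algebraize [g.toRingHom]
  have hIntgAlg : Algebra.IsIntegral (MvPolynomial (Fin s) ℂ) (MvPolynomial σ ℂ ⧸ P) :=
    ⟨fun x => hIntg x⟩
  rcases Nat.eq_zero_or_pos s with rfl | hs
  · apply Ideal.Quotient.maximal_of_isField
    apply isField_of_isIntegral_of_isField' (R := MvPolynomial (Fin 0) ℂ)
    exact (isEmptyRingEquiv ℂ (Fin 0)).toMulEquiv.isField (Field.toIsField ℂ)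
  · exfalso
    have key : ∀ c : ℂ, ∃ p ∈ zeroLocus ℂ P, ∀ q : MvPolynomial σ ℂ,
        Ideal.Quotient.mk P q = g (X ⟨0, hs⟩) → aeval p q = c := by
      intro c
      obtain ⟨Q, hQ, hQc⟩ := Ideal.exists_ideal_over_maximal_of_isIntegral
        (S := MvPolynomial σ ℂ ⧸ P) (vanishingIdeal ℂ {fun _ : Fin s => c}) (by
          have : RingHom.ker (algebraMap (MvPolynomial (Fin s) ℂ) (MvPolynomial σ ℂ ⧸ P)) = ⊥ :=
            (RingHom.injective_iff_ker_eq_bot _).1 hg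
          rw [this]; exact bot_le)
      have hM : (Ideal.comap (Ideal.Quotient.mk P) Q).IsMaximal :=
        Ideal.comap_isMaximal_of_surjective _ Ideal.Quotient.mk_surjective
      obtain ⟨p, hp⟩ := isMaximal_iff_eq_vanishingIdeal_singleton.1 hM
      have hmem : ∀ q, aeval p q = 0 ↔ Ideal.Quotient.mk P q ∈ Q := by
        intro q
        rw [← mem_vanishingIdeal_singleton_iff, ← hp]; rfl
      refine ⟨p, ?_, ?_⟩
      · intro q hq
        rw [hmem, Ideal.Quotient.eq_zero_iff_mem.2 hq]; exact Q.zero_mem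
      · intro q hq
        have h1 : (X ⟨0, hs⟩ - C c : MvPolynomial (Fin s) ℂ) ∈ vanishingIdeal ℂ {fun _ : Fin s => c} := by
          rw [mem_vanishingIdeal_singleton_iff]; simp
        rw [← hQc] at h1
        have h2 : g (X ⟨0, hs⟩ - C c) ∈ Q := h1
        have h3 : aeval p (q - C c) = 0 := by
          rw [hmem]
          rw [map_sub] at h2 ⊢
          rw [hq]
          convert h2 using 2
          exact (g.commutes c).symm
        simpa [sub_eq_zero] using h3
    obtain ⟨q, hq⟩ := Ideal.Quotient.mk_surjective (g (X ⟨0, hs⟩))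
    have : (Set.univ : Set ℂ).Countable := by
      apply (hZ.image (fun p => aeval p q)).mono
      intro c _
      obtain ⟨p, hp, h⟩ := key c
      exact ⟨p, hp, h q hq⟩
    exact not_countable_complex this

lemma combos {R : Type} [CommRing R] [IsNoetherianRing R] [Algebra ℂ R] (F : Submodule ℂ R) (N : ℕ)
    (hF : ∀ P : Ideal R, P.IsPrime → (∀ f ∈ F, f ∈ P) → (N : ℕ∞) ≤ P.height) :
    ∀ k ≤ N, ∃ g : Fin k → R, (∀ i, g i ∈ F) ∧
      ∀ P : Ideal R, P.IsPrime → (∀ i, g i ∈ P) → (k : ℕ∞) ≤ P.height := by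
  classical
  intro k
  induction k with
  | zero => intro _; exact ⟨Fin.elim0, fun i => i.elim0, fun _ _ _ => by simp⟩
  | succ k ih =>
    intro hk
    obtain ⟨g, hgF, hg⟩ := ih (by omega)
    let I := Ideal.span (Set.range g)
    have hfin := Ideal.finite_minimalPrimes_of_isNoetherianRing R I
    let s : Finset (Subspace ℂ F) :=
      (hfin.toFinset.image (fun P => (P.restrictScalars ℂ).comap F.subtype)).erase ⊤
    have hs := Subspace.biUnion_ne_univ_of_top_notMem (s := s) (by simp [s])
    obtain ⟨⟨x, hxF⟩, hx⟩ := (Set.ne_univ_iff_exists_notMem _).1 hs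
    have hx' : ∀ P ∈ I.minimalPrimes, x ∈ P → ∀ f ∈ F, f ∈ P := by
      intro P hP hxP f hf
      by_contra hfP
      apply hx
      simp only [Set.mem_iUnion]
      refine ⟨(P.restrictScalars ℂ).comap F.subtype, ?_, hxP⟩
      simp only [s, Finset.mem_erase, Finset.mem_image, Set.Finite.mem_toFinset]
      refine ⟨?_, P, hP, rfl⟩
      intro h
      have : (⟨f, hf⟩ : F) ∈ (P.restrictScalars ℂ).comap F.subtype := by rw [h]; trivial
      exact hfP this
    refine ⟨Fin.cons x g, ?_, ?_⟩
    · intro i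
      refine Fin.cases ?_ ?_ i
      · exact hxF
      · exact hgF
    · intro P hP hgP
      have hxP : x ∈ P := hgP 0
      have hIP : I ≤ P := by
        rw [Ideal.span_le]; rintro _ ⟨i, rfl⟩; exact hgP i.succ
      obtain ⟨P0, hP0, hle⟩ := Ideal.exists_minimalPrimes_le hIP
      have hP0p : P0.IsPrime := hP0.1.1
      by_cases hx0 : x ∈ P0
      · have := hF P hP (fun f hf => hle (hx' P0 hP0 hx0 f hf))
        refine le_trans ?_ this
        exact_mod_cast hk
      · have hlt : P0 < P := lt_of_le_of_ne hle (fun h => hx0 (h ▸ hxP))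
        have h1 := hg P0 hP0p (fun i => hP0.1.2 (Ideal.subset_span ⟨i, rfl⟩))
        have h2 := Ideal.height_add_one_le_of_lt_of_isPrime hlt
        refine le_trans ?_ h2
        push_cast
        gcongr

/-- Deformation step -/
lemma exists_Q {σ : Type} [Fintype σ] {S : Type} [CommRing S] [IsNoetherianRing S]
    (g u : σ → S)
    (hg : ∀ P : Ideal S, P.IsPrime → (∀ i, g i ∈ P) → (Fintype.card σ : ℕ∞) ≤ P.height)
    (M : Ideal (Polynomial S)) [M.IsPrime]
    (hM : ∀ i, Polynomial.X * Polynomial.C (u i) + Polynomial.C (g i) ∈ M) :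
    ∃ Q : Ideal (Polynomial S), Q.IsPrime ∧ Q ≤ M ∧ Polynomial.X ∉ Q ∧
      Ideal.span (Set.range fun i => Polynomial.X * Polynomial.C (u i) + Polynomial.C (g i)) ≤ Q := by
  classical
  let h : σ → Polynomial S := fun i => Polynomial.X * Polynomial.C (u i) + Polynomial.C (g i)
  have hJ : Ideal.span (Set.range h) ≤ M := by
    rw [Ideal.span_le]; rintro _ ⟨i, rfl⟩; exact hM i
  obtain ⟨Q, hQ, hle⟩ := Ideal.exists_minimalPrimes_le hJ
  have hQp : Q.IsPrime := hQ.1.1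
  refine ⟨Q, hQp, hle, ?_, hQ.1.2⟩
  intro hX
  have h1 : Q.height ≤ Fintype.card σ := by
    have := Ideal.height_le_card_of_mem_minimalPrimes_span (Set.finite_range h) hQ
    refine this.trans ?_
    have h2 : (Set.range h).ncard ≤ Fintype.card σ := by
      rw [← Set.image_univ]
      refine (Set.ncard_image_le (Set.finite_univ)).trans ?_
      simp [Set.ncard_univ]
    exact_mod_cast h2
  let q := Q.comap Polynomial.C
  have hqp : q.IsPrime := Ideal.comap_isPrime _ _
  have hgq : ∀ i, g i ∈ q := by
    intro i
    have h2 : h i ∈ Q := hQ.1.2 (Ideal.subset_span ⟨i, rfl⟩)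
    exact (Q.add_mem_iff_right (Q.mul_mem_right _ hX)).1 h2
  have h3 := hg q hqp hgq
  have hmp : (q.map Polynomial.C).IsPrime := Ideal.isPrime_map_C_of_isPrime
  have hlo : (q.map Polynomial.C).LiesOver q := ⟨by
    ext x
    simp only [Ideal.under, Ideal.mem_comap]
    change x ∈ q ↔ Polynomial.C x ∈ _
    rw [Ideal.mem_map_C_iff]
    constructor
    · intro hx n
      rw [Polynomial.coeff_C]; split_ifs
      · exact hx
      · exact q.zero_mem
    · intro hx; simpa using hx 0⟩
  have h4 := Ideal.height_eq_height_add_of_liesOver_of_hasGoingDown q (q.map Polynomial.C)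
  have hlt : q.map Polynomial.C < Q := by
    refine lt_of_le_of_ne Ideal.map_comap_le ?_
    intro he
    rw [← he, Ideal.mem_map_C_iff] at hX
    have := hX 1
    rw [Polynomial.coeff_X_one] at this
    exact hqp.ne_top ((Ideal.eq_top_iff_one _).2 this)
  have h5 := Ideal.height_add_one_le_of_lt_of_isPrime hlt
  have h6 : (Fintype.card σ : ℕ∞) + 1 ≤ Fintype.card σ := by
    refine le_trans ?_ (h5.trans h1)
    gcongr
    rw [h4]
    exact h3.trans le_self_add
  have h7 : Fintype.card σ + 1 ≤ Fintype.card σ := by exact_mod_cast h6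
  omega

end PB

namespace PB

section count
open MvPolynomial
set_option linter.unusedSectionVars false

noncomputable def gam (σ : Type) : Polynomial ℂ →+* Polynomial (MvPolynomial σ ℂ) :=
  Polynomial.mapRingHom (MvPolynomial.C)

noncomputable def hh {σ : Type} (n : ℕ) (g : σ → MvPolynomial σ ℂ) (i : σ) :
    Polynomial (MvPolynomial σ ℂ) :=
  Polynomial.X * Polynomial.C (X i ^ n) + Polynomial.C (g i)

noncomputable def mon {σ : Type} (a : σ →₀ ℕ) : Polynomial (MvPolynomial σ ℂ) :=
  Polynomial.C (monomial a 1)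

def Good {σ : Type} [Fintype σ] [DecidableEq σ] (n : ℕ) (J : Ideal (Polynomial (MvPolynomial σ ℂ)))
    (r : Polynomial (MvPolynomial σ ℂ)) : Prop :=
  ∃ b : (σ → Fin n) → Polynomial ℂ,
    r - ∑ a, gam σ (b a) * mon (Finsupp.equivFunOnFinite.symm fun i => (a i : ℕ)) ∈ J

variable {σ : Type} [Fintype σ] [DecidableEq σ] {n : ℕ} {J : Ideal (Polynomial (MvPolynomial σ ℂ))}

lemma good_of_mem {r} (hr : r ∈ J) : Good n J r := ⟨0, by simpa using hr⟩

lemma Good.add {r s} (hr : Good n J r) (hs : Good n J s) : Good n J (r + s) := by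
  obtain ⟨b, hb⟩ := hr
  obtain ⟨c, hc⟩ := hs
  refine ⟨b + c, ?_⟩
  convert J.add_mem hb hc using 1
  simp only [Pi.add_apply, map_add, add_mul, Finset.sum_add_distrib]
  ring

lemma Good.mul {r} (hr : Good n J r) (c : Polynomial ℂ) : Good n J (gam σ c * r) := by
  obtain ⟨b, hb⟩ := hr
  refine ⟨fun a => c * b a, ?_⟩
  convert J.mul_mem_left (gam σ c) hb using 1
  simp only [map_mul, mul_sub, Finset.mul_sum, mul_assoc]

lemma Good.sum {ι : Type*} (s : Finset ι) (r : ι → Polynomial (MvPolynomial σ ℂ))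
    (h : ∀ i ∈ s, Good n J (r i)) : Good n J (∑ i ∈ s, r i) := by
  classical
  induction s using Finset.induction_on with
  | empty => simpa using good_of_mem J.zero_mem
  | insert a s ha ih =>
    rw [Finset.sum_insert ha]
    exact (h a (by simp)).add (ih fun i hi => h i (by simp [hi]))

lemma good_mon (a : σ →₀ ℕ) (ha : ∀ i, a i < n) : Good n J (mon a) := by
  classical
  refine ⟨Pi.single (fun i => ⟨a i, ha i⟩) 1, ?_⟩
  rw [Finset.sum_eq_single (fun i => ⟨a i, ha i⟩)]
  · convert J.zero_mem
    simp only [Pi.single_eq_same, map_one, one_mul]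
    rw [sub_eq_zero]
    congr 1
    ext i; simp
  · intro b _ hb; simp [Pi.single_eq_of_ne hb]
  · simp

lemma C_eq_sum (E : ℕ) (ι : Finset (σ →₀ ℕ)) (hι : ∀ a, a ∈ ι ↔ a.degree ≤ E)
    (p : MvPolynomial σ ℂ) (hp : p.totalDegree ≤ E) :
    (Polynomial.C p : Polynomial (MvPolynomial σ ℂ)) =
      ∑ b : ι, gam σ (Polynomial.C (p.coeff b)) * mon (b : σ →₀ ℕ) := by
  classical
  conv_lhs => rw [p.as_sum]
  rw [map_sum, Finset.sum_coe_sort ι (fun b => gam σ (Polynomial.C (p.coeff b)) * mon b)]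
  have hsub : p.support ⊆ ι := by
    intro a ha
    rw [hι]
    exact (le_totalDegree ha).trans hp
  rw [← Finset.sum_subset hsub]
  · refine Finset.sum_congr rfl fun a _ => ?_
    simp only [gam, mon, Polynomial.coe_mapRingHom, Polynomial.map_C, ← Polynomial.C_mul]
    rw [C_mul_monomial, mul_one]
  · intro a _ ha
    rw [notMem_support_iff.1 ha]; simp

lemma row (g : σ → MvPolynomial σ ℂ) (hg : ∀ i, (g i).totalDegree ≤ n)
    (hJ : ∀ i, hh n g i ∈ J)
    (E : ℕ) (ι : Finset (σ →₀ ℕ)) (hι : ∀ a, a ∈ ι ↔ a.degree ≤ E) (a : ι) :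
    ∃ v : ι → ℂ, Good n J (Polynomial.X * mon (a : σ →₀ ℕ) +
      ∑ b : ι, gam σ (Polynomial.C (v b)) * mon (b : σ →₀ ℕ)) := by
  classical
  obtain ⟨a, ha⟩ := a
  by_cases h : ∀ i, a i < n
  · refine ⟨0, ?_⟩
    have := (good_mon (J := J) a h).mul Polynomial.X
    simpa [gam] using this
  · push Not at h
    obtain ⟨i, hi⟩ := h
    let a' := a - Finsupp.single i n
    have haa : a' + Finsupp.single i n = a := by
      apply tsub_add_cancel_of_le
      rwa [Finsupp.single_le_iff]
    let p : MvPolynomial σ ℂ := monomial a' 1 * g i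
    have hp : p.totalDegree ≤ E := by
      refine (totalDegree_mul _ _).trans ?_
      have h1 : (monomial a' (1:ℂ)).totalDegree ≤ a'.degree := by
        rw [totalDegree_monomial _ one_ne_zero]; rfl
      have h2 := (hι a).1 ha
      rw [← haa, map_add, Finsupp.degree_single] at h2
      have := hg i
      omega
    refine ⟨fun b => p.coeff b, ?_⟩
    rw [← C_eq_sum E ι hι p hp]
    apply good_of_mem
    convert J.mul_mem_left (mon a') (hJ i) using 1
    simp only [mon, hh, p, mul_add, ← haa, map_mul]
    rw [show (monomial (a' + Finsupp.single i n) (1:ℂ)) = monomial a' 1 * X i ^ n by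
      rw [X_pow_eq_monomial, monomial_mul, mul_one]]
    rw [map_mul]
    ring

lemma exists_delta (g : σ → MvPolynomial σ ℂ) (hg : ∀ i, (g i).totalDegree ≤ n)
    (hJ : ∀ i, hh n g i ∈ J) (E : ℕ) :
    ∃ δ : Polynomial ℂ, δ ≠ 0 ∧ ∀ p : MvPolynomial σ ℂ, p.totalDegree ≤ E →
      Good n J (gam σ δ * Polynomial.C p) := by
  classical
  let ι : Finset (σ →₀ ℕ) := (Finsupp.finite_of_degree_le (σ := σ) E).toFinset
  have hι : ∀ a, a ∈ ι ↔ a.degree ≤ E := by intro a; simp [ι]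
  choose v hv using row g hg hJ E ι hι
  let N : Matrix ι ι ℂ := Matrix.of v
  let B := Matrix.charmatrix (-N)
  refine ⟨(-N).charpoly, (Matrix.charpoly_monic _).ne_zero, ?_⟩
  have hB : ∀ a, Good n J (∑ b, gam σ (B a b) * mon (b : σ →₀ ℕ)) := by
    intro a
    convert hv a using 1
    have : ∀ b, B a b = (if a = b then Polynomial.X else 0) + Polynomial.C (v a b) := by
      intro b
      simp [B, Matrix.charmatrix, Matrix.diagonal_apply, N]
    simp only [this, map_add, add_mul, Finset.sum_add_distrib]
    congr 1
    rw [Finset.sum_eq_single a]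
    · simp [gam]
    · intro b _ hb; simp [Ne.symm hb]
    · simp
  have hmon : ∀ c : ι, Good n J (gam σ (-N).charpoly * mon (c : σ →₀ ℕ)) := by
    intro c
    have h1 : gam σ (-N).charpoly * mon (c : σ →₀ ℕ) =
        ∑ a, gam σ (B.adjugate c a) * ∑ b, gam σ (B a b) * mon (b : σ →₀ ℕ) := by
      simp only [Finset.mul_sum]
      rw [Finset.sum_comm]
      simp only [← mul_assoc, ← map_mul, ← Finset.sum_mul, ← map_sum]
      simp only [← Matrix.mul_apply, Matrix.adjugate_mul]
      rw [Finset.sum_eq_single c]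
      · simp [Matrix.charpoly, B]
      · intro b _ hb; simp [Matrix.one_apply_ne hb.symm]
      · simp
    rw [h1]
    exact Good.sum _ _ fun a _ => (hB a).mul _
  intro p hp
  rw [C_eq_sum E ι hι p hp, Finset.mul_sum]
  refine Good.sum _ _ fun b _ => ?_
  rw [mul_left_comm]
  exact (hmon b).mul _

lemma interp (T : Finset (σ → ℂ)) : ∃ e : (σ → ℂ) → MvPolynomial σ ℂ,
    ∀ p ∈ T, ∀ q ∈ T, eval q (e p) = if p = q then 1 else 0 := by
  classical
  have hsep : ∀ p q : σ → ℂ, ∃ f : MvPolynomial σ ℂ, p ≠ q → eval p f = 1 ∧ eval q f = 0 := by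
    intro p q
    by_cases h : p = q
    · exact ⟨0, fun h' => absurd h h'⟩
    · obtain ⟨k, hk⟩ := Function.ne_iff.1 h
      refine ⟨C (p k - q k)⁻¹ * (X k - C (q k)), fun _ => ?_⟩
      have := sub_ne_zero.2 hk
      simp [this]
  choose f hf using hsep
  refine ⟨fun p => ∏ q ∈ T.erase p, f p q, ?_⟩
  intro p hp q hq
  rw [map_prod]
  split_ifs with h
  · subst h
    exact Finset.prod_eq_one fun r hr => (hf p r (Finset.ne_of_mem_erase hr).symm).1
  · exact Finset.prod_eq_zero (Finset.mem_erase.2 ⟨Ne.symm h, hq⟩) (hf p q h).2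

lemma count (g : σ → MvPolynomial σ ℂ) (hg : ∀ i, (g i).totalDegree ≤ n)
    (T : Finset (σ → ℂ))
    (K : Ideal (Polynomial (MvPolynomial σ ℂ))) (hK : ∀ i, hh n g i ∈ K)
    (hX : ∀ r, Polynomial.X * r ∈ K → r ∈ K)
    (hev : ∀ p ∈ T, ∀ r ∈ K, eval p (Polynomial.eval 0 r) = 0) :
    T.card ≤ n ^ Fintype.card σ := by
  classical
  obtain ⟨e, he⟩ := interp T
  let E := T.sup fun p => (e p).totalDegree
  obtain ⟨δ, hδ, hgood⟩ := exists_delta g hg hK E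
  have h1 : ∀ p : T, Good n K (gam σ δ * Polynomial.C (e p)) := fun p =>
    hgood _ (Finset.le_sup (f := fun p => (e p).totalDegree) p.2)
  choose b hb using h1
  by_contra hcard
  have hnli : ¬ LinearIndependent (Polynomial ℂ) b := by
    intro hli
    have := hli.fintype_card_le_finrank
    simp at this
    omega
  obtain ⟨c, hc, i0, hi0⟩ := Fintype.not_linearIndependent_iff.1 hnli
  -- relation
  have hrel : ∑ p : T, gam σ (c p * δ) * Polynomial.C (e p) ∈ K := by
    have h2 := K.sum_mem (t := Finset.univ) fun p _ => K.mul_mem_left (gam σ (c p)) (hb p)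
    convert h2 using 1
    simp only [mul_sub, Finset.sum_sub_distrib, Finset.mul_sum, map_mul, mul_assoc]
    rw [Finset.sum_comm (γ := T)]
    simp only [← mul_assoc, ← map_mul, ← Finset.sum_mul, ← map_sum]
    have h3 : ∀ a, ∑ p : T, c p * b p a = 0 := by
      intro a
      have := congrFun hc a
      simpa using this
    simp only [h3, map_zero, zero_mul, Finset.sum_const_zero, sub_zero]
  have hdiv : ∀ k : ℕ, ∀ c : T → Polynomial ℂ,
      ∑ p : T, gam σ (c p) * Polynomial.C (e p) ∈ K → ∀ p, Polynomial.X ^ k ∣ c p := by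
    intro k
    induction k with
    | zero => intro c _ p; simp
    | succ k ih =>
      intro c hc
      have h0 : ∀ p, Polynomial.X ∣ c p := by
        intro p
        have h4 := hev p p.2 _ hc
        rw [Polynomial.eval_finsetSum, map_sum, Finset.sum_eq_single p] at h4
        · rw [Polynomial.X_dvd_iff, Polynomial.coeff_zero_eq_eval_zero]
          simp [gam, he p p.2 p p.2, Polynomial.eval_map, Polynomial.eval₂_at_zero] at h4
          rw [← Polynomial.coeff_zero_eq_eval_zero]
          exact h4
        · intro q _ hq
          simp [he q q.2 p p.2, hq]
        · simp
      choose d hd using h0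
      have h5 : ∑ p : T, gam σ (d p) * Polynomial.C (e p) ∈ K := by
        apply hX
        convert hc using 1
        rw [Finset.mul_sum]
        refine Finset.sum_congr rfl fun p _ => ?_
        rw [hd p, map_mul, mul_assoc]
        simp [gam]
      intro p
      rw [hd p, pow_succ']
      exact mul_dvd_mul_left _ (ih d h5 p)
  have hz : c i0 * δ = 0 := by
    ext k
    have := hdiv (k+1) _ hrel i0
    rw [Polynomial.X_pow_dvd_iff] at this
    simpa using this k (by omega)
  rcases mul_eq_zero.1 hz with h | h
  · exact hi0 h
  · exact hδ h

end count
end PB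

namespace PB

open MvPolynomial in
lemma bezout {σ : Type} [Fintype σ] [DecidableEq σ] (n : ℕ) (F : Set (MvPolynomial σ ℂ))
    (hdeg : ∀ f ∈ F, f.totalDegree ≤ n)
    (hZ : {p : σ → ℂ | ∀ f ∈ F, eval p f = 0}.Countable)
    (T : Finset (σ → ℂ)) (hT : ∀ p ∈ T, ∀ f ∈ F, eval p f = 0) :
    T.card ≤ n ^ Fintype.card σ := by
  classical
  have hF : ∀ P : Ideal (MvPolynomial σ ℂ), P.IsPrime →
      (∀ f ∈ Submodule.span ℂ F, f ∈ P) → ((Fintype.card σ : ℕ) : ℕ∞) ≤ P.height := by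
    intro P hP hPF
    have : P.IsMaximal := by
      apply prime_max
      apply hZ.mono
      intro p hp f hf
      have := hp f (hPF f (Submodule.subset_span hf))
      simpa [aeval_eq_eval] using this
    have h := mv_height σ P
    rwa [Nat.card_eq_fintype_card] at h
  obtain ⟨g0, hg0F, hg0⟩ := combos (Submodule.span ℂ F) (Fintype.card σ) hF _ le_rfl
  let g : σ → MvPolynomial σ ℂ := fun i => g0 (Fintype.equivFin σ i)
  have hspan : ∀ f ∈ Submodule.span ℂ F, f.totalDegree ≤ n ∧ ∀ p ∈ T, eval p f = 0 := by
    intro f hf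
    induction hf using Submodule.span_induction with
    | mem x hx => exact ⟨hdeg x hx, fun p hp => hT p hp x hx⟩
    | zero => simp
    | add x y _ _ hx hy =>
      exact ⟨(totalDegree_add _ _).trans (max_le hx.1 hy.1),
        fun p hp => by rw [map_add, hx.2 p hp, hy.2 p hp, add_zero]⟩
    | smul a x _ hx =>
      exact ⟨(totalDegree_smul_le _ _).trans hx.1, fun p hp => by simp [hx.2 p hp]⟩
  have hgF : ∀ i, g i ∈ Submodule.span ℂ F := fun i => hg0F _
  have hgP : ∀ P : Ideal (MvPolynomial σ ℂ), P.IsPrime → (∀ i, g i ∈ P) →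
      (Fintype.card σ : ℕ∞) ≤ P.height := by
    intro P hP h
    apply hg0 P hP
    intro i
    have := h ((Fintype.equivFin σ).symm i)
    simpa [g] using this
  have hQ : ∀ p : T, ∃ Q : Ideal (Polynomial (MvPolynomial σ ℂ)), Q.IsPrime ∧
      Q ≤ RingHom.ker ((eval (p : σ → ℂ)).comp (Polynomial.evalRingHom 0)) ∧
      Polynomial.X ∉ Q ∧ Ideal.span (Set.range fun i => Polynomial.X * Polynomial.C (X i ^ n)
        + Polynomial.C (g i)) ≤ Q := by
    intro p
    have : (RingHom.ker ((eval (p : σ → ℂ)).comp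
      (Polynomial.evalRingHom (0 : MvPolynomial σ ℂ)))).IsPrime := RingHom.ker_isPrime _
    apply exists_Q g (fun i => X i ^ n) hgP
    intro i
    rw [RingHom.mem_ker]
    simp [(hspan _ (hgF i)).2 p p.2]
  choose Q hQp hQM hQX hQJ using hQ
  apply count g (fun i => (hspan _ (hgF i)).1) T (⨅ p, Q p)
  · intro i
    rw [Ideal.mem_iInf]
    intro p
    exact hQJ p (Ideal.subset_span ⟨i, rfl⟩)
  · intro r hr
    rw [Ideal.mem_iInf] at hr ⊢
    intro p
    exact ((hQp p).mem_or_mem (hr p)).resolve_left (hQX p)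
  · intro p hp r hr
    rw [Ideal.mem_iInf] at hr
    exact hQM ⟨p, hp⟩ (hr ⟨p, hp⟩)

open MvPolynomial in
lemma main_count {σ : Type} [Fintype σ] [DecidableEq σ] {V U : Type*} [AddCommGroup V] [Module ℂ V]
    [AddCommGroup U] [Module ℂ U] [FiniteDimensional ℂ V]
    (D0 : V →ₗ[ℂ] U) (D : σ → (V →ₗ[ℂ] U))
    (hZ : {x : σ → ℂ | ∃ f : V, f ≠ 0 ∧ D0 f = ∑ s, x s • D s f}.Countable) :
    {x : σ → ℂ | ∃ f : V, f ≠ 0 ∧ D0 f = ∑ s, x s • D s f}.Finite ∧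
    {x : σ → ℂ | ∃ f : V, f ≠ 0 ∧ D0 f = ∑ s, x s • D s f}.ncard ≤
      Module.finrank ℂ V ^ Fintype.card σ := by
  classical
  set Z := {x : σ → ℂ | ∃ f : V, f ≠ 0 ∧ D0 f = ∑ s, x s • D s f} with hZdef
  let n := Module.finrank ℂ V
  let v := Module.finBasis ℂ V
  let P : (Fin n → (U →ₗ[ℂ] ℂ)) → Matrix (Fin n) (Fin n) (MvPolynomial σ ℂ) := fun φ =>
    Matrix.of fun i l => C (φ i (D0 (v l))) - ∑ s, X s * C (φ i (D s (v l)))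
  have hPe : ∀ φ x i l, eval x (P φ i l) = φ i (D0 (v l) - ∑ s, x s • D s (v l)) := by
    intro φ x i l
    simp [P]
  have hPdeg : ∀ φ i l, (P φ i l).totalDegree ≤ 1 := by
    intro φ i l
    refine (totalDegree_sub _ _).trans (max_le (by simp) ?_)
    refine totalDegree_finsetSum_le fun s _ => ?_
    refine (totalDegree_mul _ _).trans ?_
    simp
  have hdet : ∀ φ x, eval x (P φ).det =
      (Matrix.of fun i l => φ i (D0 (v l) - ∑ s, x s • D s (v l))).det := by
    intro φ x
    rw [RingHom.map_det]
    congr 1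
    ext i l
    exact hPe φ x i l
  let F : Set (MvPolynomial σ ℂ) := Set.range fun φ => (P φ).det
  have hFdeg : ∀ f ∈ F, f.totalDegree ≤ n := by
    rintro _ ⟨φ, rfl⟩
    dsimp only
    rw [Matrix.det_apply]
    refine totalDegree_finsetSum_le fun τ _ => ?_
    rw [Units.smul_def, zsmul_eq_mul]
    refine (totalDegree_mul _ _).trans ?_
    have h1 : (((τ.sign : ℤ) : MvPolynomial σ ℂ)).totalDegree = 0 := by
      rw [← map_intCast (C : ℂ →+* MvPolynomial σ ℂ)]; exact totalDegree_C _
    rw [h1, zero_add]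
    refine (totalDegree_finsetProd _ _).trans ?_
    refine (Finset.sum_le_card_nsmul _ _ 1 fun i _ => hPdeg _ _ _).trans ?_
    simp
  have hiff : ∀ x, x ∈ Z ↔ ∀ f ∈ F, eval x f = 0 := by
    intro x
    let M : V →ₗ[ℂ] U := D0 - ∑ s, x s • D s
    have hM : ∀ f, M f = D0 f - ∑ s, x s • D s f := by
      intro f; simp [M, LinearMap.sum_apply]
    constructor
    · rintro ⟨f, hf0, hf⟩ _ ⟨φ, rfl⟩
      dsimp only
      rw [hdet]
      rw [← Matrix.exists_mulVec_eq_zero_iff]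
      refine ⟨v.repr f, ?_, ?_⟩
      · intro h
        apply hf0
        apply v.repr.injective
        ext i
        simpa using congrFun h i
      · ext i
        simp only [Matrix.mulVec, dotProduct, Matrix.of_apply, Pi.zero_apply]
        have h2 : φ i (M f) = 0 := by rw [hM, hf, sub_self, map_zero]
        rw [← v.sum_repr f, map_sum, map_sum] at h2
        rw [← h2]
        refine Finset.sum_congr rfl fun l _ => ?_
        rw [← hM, map_smul, map_smul, smul_eq_mul, mul_comm]
    · intro h
      by_contra hx
      have hker : LinearMap.ker M = ⊥ := by
        rw [LinearMap.ker_eq_bot']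
        intro f hf
        by_contra hf0
        exact hx ⟨f, hf0, by rw [hM, sub_eq_zero] at hf; exact hf⟩
      obtain ⟨G, hG⟩ := LinearMap.exists_leftInverse_of_injective M hker
      let φ : Fin n → (U →ₗ[ℂ] ℂ) := fun i => (v.coord i) ∘ₗ G
      have h1 := h _ ⟨φ, rfl⟩
      dsimp only at h1
      rw [hdet] at h1
      have h2 : (Matrix.of fun i l => φ i (D0 (v l) - ∑ s, x s • D s (v l))) =
          (1 : Matrix (Fin n) (Fin n) ℂ) := by
        ext i l
        rw [Matrix.of_apply, ← hM]
        have : G (M (v l)) = v l := LinearMap.congr_fun hG (v l)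
        simp only [φ, LinearMap.comp_apply, this]
        simp [Matrix.one_apply, Finsupp.single_apply, eq_comm]
      rw [h2, Matrix.det_one] at h1
      exact one_ne_zero h1
  have hZ' : {p : σ → ℂ | ∀ f ∈ F, eval p f = 0}.Countable := by
    convert hZ using 1
    ext x; exact (hiff x).symm
  have key : ∀ T : Finset (σ → ℂ), (T : Set (σ → ℂ)) ⊆ Z → T.card ≤ n ^ Fintype.card σ :=
    fun T hT => bezout n F hFdeg hZ' T fun p hp => (hiff p).1 (hT hp)
  have hfin : Z.Finite := by
    by_contra hinf
    obtain ⟨T, hTZ, hTc⟩ := Set.Infinite.exists_subset_card_eq hinf (n ^ Fintype.card σ + 1)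
    have := key T hTZ
    omega
  refine ⟨hfin, ?_⟩
  rw [Set.ncard_eq_toFinset_card _ hfin]
  exact key _ (by simp)

end PB

/-- Let `A` be an affine `ℂ`-algebra, `L₁,…,L_m : A → A` be `ℂ`-linear
maps, and `V, W` finite-dimensional `ℂ`-subspaces of `A`.  Let `X` be the set of nonzero
`f ∈ V` with `L_j f / f ∈ W` (i.e. `L_j f = f * w` for some `w ∈ W`) for all `j`.  Then
the image of `X` in `ℙ(V)` — the set of lines `ℂ·f` spanned by elements `f ∈ X` — is
either uncountable or has cardinality at most `(dim V) ^ (2 + m·dim W)`. -/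
theorem projective_image_uncountable_or_small
    (A : Type*) [CommRing A] [IsDomain A] [Algebra ℂ A]
    (hfg : Algebra.FiniteType ℂ A)
    (m : ℕ) (L : Fin m → (A →ₗ[ℂ] A))
    (V W : Submodule ℂ A) (hV : FiniteDimensional ℂ V) (hW : FiniteDimensional ℂ W) :
    let X : Set A := {f | f ≠ 0 ∧ f ∈ V ∧ ∀ j : Fin m, ∃ w ∈ W, L j f = f * w}
    let S : Set (Submodule ℂ A) := (fun f => Submodule.span ℂ {f}) '' X
    ¬ S.Countable ∨
      (S.Finite ∧ S.ncard ≤ (Module.finrank ℂ V) ^ (2 + m * Module.finrank ℂ W)) := by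
  classical
  intro X S
  by_cases hS : S.Countable
  swap
  · exact Or.inl hS
  right
  let d := Module.finrank ℂ W
  let bW := Module.finBasis ℂ W
  let w : (Fin m × Fin d → ℂ) → Fin m → A := fun x j => ∑ k, x (j, k) • (bW k : A)
  have hwW : ∀ x j, w x j ∈ W := fun x j =>
    W.sum_mem fun k _ => W.smul_mem _ (bW k).2
  have hwinj : ∀ x y, w x = w y → x = y := by
    intro x y h
    ext ⟨j, k⟩
    have h1 : ∑ k, x (j, k) • bW k = ∑ k, y (j, k) • bW k := by
      apply Subtype.ext
      simpa [w] using congrFun h j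
    have h2 := congrArg (fun z => bW.repr z k) h1
    simpa [Finsupp.single_apply] using h2
  let rel : (Fin m × Fin d → ℂ) → A → Prop := fun x f =>
    f ≠ 0 ∧ f ∈ V ∧ ∀ j, L j f = f * w x j
  have relX : ∀ x f, rel x f → f ∈ X := fun x f h =>
    ⟨h.1, h.2.1, fun j => ⟨w x j, hwW x j, h.2.2 j⟩⟩
  have Xrel : ∀ f ∈ X, ∃ x, rel x f := by
    rintro f ⟨hf0, hfV, hf⟩
    choose u huW hu using hf
    refine ⟨fun s => bW.repr ⟨u s.1, huW s.1⟩ s.2, hf0, hfV, fun j => ?_⟩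
    rw [hu j]
    congr 1
    have := congrArg Subtype.val (bW.sum_repr ⟨u j, huW j⟩)
    rw [Submodule.coe_sum] at this
    exact this.symm
  have reluniq : ∀ x y f, rel x f → rel y f → x = y := by
    intro x y f hx hy
    apply hwinj
    funext j
    apply mul_left_cancel₀ hx.1
    rw [← hx.2.2 j, ← hy.2.2 j]
  have relsmul : ∀ x f (c : ℂ), c ≠ 0 → rel x f → rel x (c • f) := by
    intro x f c hc h
    refine ⟨smul_ne_zero hc h.1, V.smul_mem _ h.2.1, fun j => ?_⟩
    rw [map_smul, h.2.2 j, smul_mul_assoc]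
  have relspan : ∀ x f f', rel x f → rel x f' →
      Submodule.span ℂ {f} = Submodule.span ℂ {f'} := by
    intro x f f' hf hf'
    by_contra hne
    have hli : LinearIndependent ℂ ![f, f'] := by
      rw [LinearIndependent.pair_iff' hf.1]
      intro a ha
      apply hne
      have ha0 : a ≠ 0 := by
        rintro rfl
        exact hf'.1 (by rw [← ha, zero_smul])
      rw [← ha]
      exact (Submodule.span_singleton_smul_eq (IsUnit.mk0 a ha0) f).symm
    rw [LinearIndependent.pair_iff] at hli
    have h0 : ∀ c : ℂ, f + c • f' ≠ 0 := by
      intro c h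
      have := hli 1 c (by rw [one_smul]; exact h)
      exact one_ne_zero this.1
    have hmem : ∀ c : ℂ, Submodule.span ℂ {f + c • f'} ∈ S := by
      intro c
      refine ⟨f + c • f', relX x _ ⟨h0 c, V.add_mem hf.2.1 (V.smul_mem _ hf'.2.1), fun j => ?_⟩, rfl⟩
      rw [map_add, map_smul, hf.2.2 j, hf'.2.2 j, add_mul, smul_mul_assoc]
    have hinj : Function.Injective fun c : ℂ => Submodule.span ℂ {f + c • f'} := by
      intro c c' h
      have h1 : f + c • f' ∈ Submodule.span ℂ {f + c' • f'} := by
        have : f + c • f' ∈ Submodule.span ℂ {f + c • f'} := Submodule.mem_span_singleton_self _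
        rwa [show Submodule.span ℂ {f + c • f'} = Submodule.span ℂ {f + c' • f'} from h] at this
      obtain ⟨a, ha⟩ := Submodule.mem_span_singleton.1 h1
      have h2 := hli (a - 1) (a * c' - c) (by
        rw [sub_smul, sub_smul, mul_smul, one_smul]
        rw [smul_add] at ha
        rw [sub_add_sub_comm, ha, sub_self])
      have h3 : a = 1 := sub_eq_zero.1 h2.1
      have h4 := h2.2
      rw [h3, one_mul, sub_eq_zero] at h4
      exact h4.symm
    have hc : (Set.univ : Set ℂ).Countable :=
      Set.MapsTo.countable_of_injOn (fun c _ => hmem c) hinj.injOn hS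
    exact not_countable_complex hc
  let D0 : V →ₗ[ℂ] (Fin m → A) := LinearMap.pi fun j => (L j) ∘ₗ V.subtype
  let D : Fin m × Fin d → (V →ₗ[ℂ] (Fin m → A)) := fun s =>
    (LinearMap.single ℂ (fun _ => A) s.1) ∘ₗ (LinearMap.mulRight ℂ (bW s.2 : A)) ∘ₗ V.subtype
  have hsum : ∀ (x : Fin m × Fin d → ℂ) (f : V) j, (∑ s, x s • D s f) j = (f : A) * w x j := by
    intro x f j
    rw [Finset.sum_apply, Fintype.sum_prod_type, Finset.sum_eq_single j]
    · simp [D, w, Finset.mul_sum]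
    · intro b _ hb
      simp [D, Pi.single_eq_of_ne hb.symm]
    · simp
  let Z : Set (Fin m × Fin d → ℂ) := {x | ∃ f : V, f ≠ 0 ∧ D0 f = ∑ s, x s • D s f}
  have hZrel : ∀ x, x ∈ Z ↔ ∃ f, rel x f := by
    intro x
    constructor
    · rintro ⟨f, hf0, hf⟩
      refine ⟨f, by simpa using hf0, f.2, fun j => ?_⟩
      rw [← hsum, ← hf]; rfl
    · rintro ⟨f, hf0, hfV, hf⟩
      refine ⟨⟨f, hfV⟩, by simpa using hf0, ?_⟩
      funext j
      rw [hsum]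
      exact hf j
  have hZc : Z.Countable := by
    choose! φ hφ using fun x => (hZrel x).1
    refine Set.MapsTo.countable_of_injOn (f := fun x => Submodule.span ℂ {φ x}) (t := S)
      (fun x hx => ⟨φ x, relX x _ (hφ x hx), rfl⟩) ?_ hS
    intro x hx y hy h
    obtain ⟨z, hz⟩ := Submodule.span_singleton_eq_span_singleton.1 h
    have h1 := relsmul x (φ x) (z : ℂ) z.ne_zero (hφ x hx)
    have h2 : (z : ℂ) • φ x = φ y := hz
    rw [h2] at h1
    exact reluniq x y _ h1 (hφ y hy)
  obtain ⟨hZf, hZn⟩ := PB.main_count D0 D hZc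
  have hSx : ∀ ℓ ∈ S, ∃ x f, rel x f ∧ Submodule.span ℂ {f} = ℓ := by
    rintro ℓ ⟨f, hf, rfl⟩
    obtain ⟨x, hx⟩ := Xrel f hf
    exact ⟨x, f, hx, rfl⟩
  choose! ξ ψ hξ using hSx
  have hmaps : Set.MapsTo ξ S Z := fun ℓ hℓ => (hZrel _).2 ⟨_, (hξ ℓ hℓ).1⟩
  have hinj : Set.InjOn ξ S := by
    intro a ha b hb h
    rw [← (hξ a ha).2, ← (hξ b hb).2]
    apply relspan (ξ a) _ _ (hξ a ha).1
    rw [h]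
    exact (hξ b hb).1
  refine ⟨Set.Finite.of_injOn hmaps hinj hZf, ?_⟩
  rcases Nat.eq_zero_or_pos (Module.finrank ℂ V) with h0 | hpos
  · have hV0 : V = ⊥ := Submodule.finrank_eq_zero.1 h0
    have : S = ∅ := by
      rw [Set.eq_empty_iff_forall_notMem]
      rintro _ ⟨f, hf, rfl⟩
      apply hf.1
      have := hf.2.1
      rwa [hV0, Submodule.mem_bot] at this
    rw [this]; simp
  · refine (Set.ncard_le_ncard_of_injOn ξ hmaps hinj hZf).trans (hZn.trans ?_)
    apply Nat.pow_le_pow_right hpos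
    simp [d]
end

section
/- Let A be an integrally closed affine ℂ-algebra (a finitely generated, integrally closed, integral domain ℂ-algebra) with ℂ-linear derivations δ1,...,δm. Suppose there exists an infinite sequence of elements r1, r2, ... of A such that δj(r_i)/r_i ∈ A (i.e., δj(r_i) ∈ r_i·A) for all j = 1,...,m and all i ≥ 1, and such that their images in the quotient monoid (A∖{0})/ℂ^× generate a free abelian semigroup freely generated by them; concretely, whenever ∏ r_i^{a_i} = λ·∏ r_i^{b_i} for some λ ∈ ℂ^× and finitely supported tuples of non-negative integers (a_i), (b_i), one has a_i = b_i for all i. Then there exists f ∈ Frac(A) with f ∉ ℂ and δj(f) = 0 for all j = 1,...,m, where each δj is extended uniquely to Frac(A). -/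
theorem pc_ext (R S T : Type*) [CommRing R] [CommRing S] [CommRing T] [Algebra R S] [Algebra R T]
    [Algebra S T] [IsScalarTower R S T] [Algebra.FormallyEtale S T]
    (d : Derivation R S T) :
    ∃ D : Derivation R T T, ∀ s : S, D (algebraMap S T s) = d s := by
  let e := KaehlerDifferential.tensorKaehlerEquivOfFormallyEtale R S T
  let l : TensorProduct S T (Ω[S⁄R]) →ₗ[T] T :=
    TensorProduct.AlgebraTensorModule.lift
      ((LinearMap.toSpanSingleton T (Ω[S⁄R] →ₗ[S] T) d.liftKaehlerDifferential))
  refine ⟨(l.comp e.symm.toLinearMap).compDer (KaehlerDifferential.D R T), fun s => ?_⟩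
  have := KaehlerDifferential.tensorKaehlerEquivOfFormallyEtale_symm_D_algebraMap R S T s
  simp [e, this, l]

open Differential in
theorem pc_trace (L K : Type*) [Field L] [Field K] [CharZero L] [Algebra L K]
    [FiniteDimensional L K] (DL : Derivation ℤ L L) (DK : Derivation ℤ K K)
    (h : ∀ x, DK (algebraMap L K x) = algebraMap L K (DL x)) (r : K) (hr : r ≠ 0) :
    Algebra.trace L K (DK r / r) = DL (Algebra.norm L r) / Algebra.norm L r := by
  let E := AlgebraicClosure L
  have : Algebra.FormallyEtale L E := Algebra.FormallyEtale.of_isSeparable L E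
  let d0 : Derivation ℤ L E := (Algebra.linearMap L E).compDer DL
  obtain ⟨DE, hDE⟩ := pc_ext ℤ L E d0
  let : Differential L := ⟨DL⟩
  let : Differential K := ⟨DK⟩
  let : Differential E := ⟨DE⟩
  have : DifferentialAlgebra L K := ⟨h⟩
  have : DifferentialAlgebra L E := ⟨hDE⟩
  apply (algebraMap L E).injective
  rw [trace_eq_sum_embeddings E]
  change _ = algebraMap L E (logDeriv (Algebra.norm L r))
  rw [← logDeriv_algebraMap, Algebra.norm_eq_prod_embeddings, Differential.logDeriv_prod]
  · refine Finset.sum_congr rfl fun σ _ => ?_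
    rw [map_div₀]
    unfold Differential.logDeriv
    rw [← algHom_deriv' σ σ.injective]
    rfl
  · intro σ _
    simpa using hr

open Polynomial in
/-- `z` is regular at `X = 0` with value `c`. -/
def PcEv (F L : Type*) [Field F] [Field L] [Algebra F[X] L] (z : L) (c : F) : Prop :=
  ∃ g h : F[X], h.eval 0 ≠ 0 ∧ z * algebraMap F[X] L h = algebraMap F[X] L g ∧
    g.eval 0 = c * h.eval 0

section
open Polynomial
variable {F L : Type*} [Field F] [Field L] [Algebra F[X] L] 

theorem PcEv.add {z w : L} {c d : F} (h1 : PcEv F L z c) (h2 : PcEv F L w d) :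
    PcEv F L (z + w) (c + d) := by
  obtain ⟨g, h, a, b, e⟩ := h1
  obtain ⟨g', h', a', b', e'⟩ := h2
  refine ⟨g * h' + g' * h, h * h', by simp [a, a'], ?_, ?_⟩
  · rw [map_add, map_mul, map_mul, map_mul, ← b, ← b']; ring
  · simp [e, e']; ring

theorem PcEv.smul {z : L} {c : F} (h1 : PcEv F L z c) (a : F) :
    PcEv F L (algebraMap F[X] L (C a) * z) (a * c) := by
  obtain ⟨g, h, x, b, e⟩ := h1
  refine ⟨C a * g, h, x, ?_, ?_⟩
  · rw [map_mul, ← b]; ring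
  · simp [e]; ring

theorem PcEv.zero : PcEv F L 0 0 := ⟨0, 1, by simp, by simp, by simp⟩

theorem PcEv.sum {ι : Type*} (s : Finset ι) (z : ι → L) (c : ι → F)
    (h : ∀ i ∈ s, PcEv F L (z i) (c i)) : PcEv F L (∑ i ∈ s, z i) (∑ i ∈ s, c i) := by
  classical
  induction s using Finset.induction_on with
  | empty => simpa using PcEv.zero
  | insert a s ha ih =>
    rw [Finset.sum_insert ha, Finset.sum_insert ha]
    exact (h a (by simp)).add (ih fun i hi => h i (by simp [hi]))

theorem PcEv.unique [FaithfulSMul F[X] L] {z : L} {c d : F} (h1 : PcEv F L z c)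
    (h2 : PcEv F L z d) : c = d := by
  obtain ⟨g, h, a, b, e⟩ := h1
  obtain ⟨g', h', a', b', e'⟩ := h2
  have : g * h' = g' * h := by
    apply FaithfulSMul.algebraMap_injective F[X] L
    rw [map_mul, map_mul, ← b, ← b']; ring
  have := congrArg (eval 0) this
  simp only [eval_mul, e, e'] at this
  have h3 : (c - d) * (h.eval 0 * h'.eval 0) = 0 := by linear_combination this
  simpa [a, a', sub_eq_zero] using h3

theorem PcEv.const (c : F) : PcEv F L (algebraMap F[X] L (C c)) c :=
  ⟨C c, 1, by simp, by simp, by simp⟩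

theorem pc_ev_poly [FaithfulSMul F[X] L] (D : Derivation ℤ L L)
    (hD : ∀ p : F[X], D (algebraMap F[X] L p) = algebraMap F[X] L (derivative p))
    (p : F[X]) (hp : p ≠ 0) :
    ∃ e : ℤ, PcEv F L (algebraMap F[X] L X * (D (algebraMap F[X] L p) / algebraMap F[X] L p)) e := by
  obtain ⟨a, ha, ha'⟩ := exists_eq_pow_rootMultiplicity_mul_and_not_dvd p hp 0
  set n := p.rootMultiplicity 0
  have ha0 : a.eval 0 ≠ 0 := by
    intro h
    exact ha' (dvd_iff_isRoot.2 h)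
  have hane : a ≠ 0 := by rintro rfl; simp at ha0
  refine ⟨n, (n : F[X]) * a + X * derivative a, a, ha0, ?_, by simp⟩
  have hinj := FaithfulSMul.algebraMap_injective F[X] L
  have hpn : algebraMap F[X] L p ≠ 0 := by rwa [Ne, map_eq_zero_iff _ hinj]
  rw [hD, ← mul_div_assoc, div_mul_eq_mul_div, div_eq_iff hpn]
  simp only [← map_mul]
  congr 1
  simp only [map_zero, sub_zero] at ha
  conv_lhs => rw [ha]
  conv_rhs => rw [ha]
  simp only [derivative_mul, derivative_X_pow]
  rcases Nat.eq_zero_or_pos n with h0 | h0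
  · simp [h0]
  · obtain ⟨k, hk⟩ : ∃ k, n = k + 1 := ⟨n - 1, by omega⟩
    rw [hk]; simp; ring

theorem pc_ev [IsFractionRing F[X] L] (D : Derivation ℤ L L)
    (hD : ∀ p : F[X], D (algebraMap F[X] L p) = algebraMap F[X] L (derivative p))
    (q : L) (hq : q ≠ 0) :
    ∃ e : ℤ, PcEv F L (algebraMap F[X] L X * (D q / q)) e := by
  obtain ⟨a, b, hb, rfl⟩ := IsFractionRing.div_surjective (A := F[X]) q
  have hb' : algebraMap F[X] L b ≠ 0 := by simpa using nonZeroDivisors.ne_zero hb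
  have ha' : algebraMap F[X] L a ≠ 0 := by rintro h; simp [h] at hq
  have : FaithfulSMul F[X] L := IsFractionRing.instFaithfulSMul _ _
  obtain ⟨e1, h1⟩ := pc_ev_poly D hD a (by rintro rfl; simp at ha')
  obtain ⟨e2, h2⟩ := pc_ev_poly D hD b (by rintro rfl; simp at hb')
  refine ⟨e1 - e2, ?_⟩
  have := h1.add (h2.smul (-1))
  convert this using 1
  · rw [Derivation.leibniz_div]
    simp
    field_simp
    ring
  · push_cast; ring

end

/-- Contraction-style Lie derivative independence. -/
theorem pc_lie (K V : Type*) [Field K] [Algebra ℂ K] [AddCommGroup V] [Module K V] [Module ℂ V]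
    [IsScalarTower ℂ K V] {J : Type*} (δ : J → Derivation ℂ K K)
    (hconst : ∀ f : K, (∀ j, δ j f = 0) → ∃ c : ℂ, f = algebraMap ℂ K c)
    (Lie : J → V →+ V) (hLie : ∀ j f v, Lie j (f • v) = δ j f • v + f • Lie j v)
    {ι : Type*} (v : ι → V) (hv : ∀ j i, Lie j (v i) = 0) (hli : LinearIndependent ℂ v) :
    LinearIndependent K v := by
  classical
  rw [linearIndependent_iff']
  intro s
  induction s using Finset.strongInduction with
  | H s ih =>
  intro g hg i hi
  by_contra hgi
  -- normalise
  let f : ι → K := fun k => (g i)⁻¹ * g k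
  have hf : ∑ k ∈ s, f k • v k = 0 := by
    simp only [f, mul_smul, ← Finset.smul_sum, hg, smul_zero]
  have hfi : f i = 1 := by simp [f, hgi]
  have hz : ∀ j, ∀ k ∈ s, δ j (f k) = 0 := by
    intro j
    have h1 := congrArg (Lie j) hf
    simp only [map_sum, hLie, hv, smul_zero, add_zero, map_zero] at h1
    have h2 : ∑ k ∈ s.erase i, δ j (f k) • v k = 0 := by
      rw [← Finset.add_sum_erase s _ hi] at h1
      simpa [hfi] using h1
    have h3 := ih (s.erase i) (Finset.erase_ssubset hi) _ h2
    intro k hk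
    by_cases hki : k = i
    · rw [hki, hfi]; simp
    · exact h3 k (by simp [hki, hk])
  have : ∀ k, ∃ c : ℂ, k ∈ s → f k = algebraMap ℂ K c := by
    intro k
    by_cases hk : k ∈ s
    · obtain ⟨c, hc⟩ := hconst (f k) (fun j => hz j k hk)
      exact ⟨c, fun _ => hc⟩
    · exact ⟨0, fun h => absurd h hk⟩
  choose c hc using this
  have h4 : ∑ k ∈ s, c k • v k = 0 := by
    rw [← hf]
    refine Finset.sum_congr rfl fun k hk => ?_
    rw [hc k hk, algebraMap_smul]
  have h5 := linearIndependent_iff'.1 hli s c h4 i hi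
  have h6 := hc i hi
  rw [h5, hfi] at h6
  simp at h6

open Polynomial in
theorem pc_core (F L K : Type*) [Field F] [CharZero F] [Field K] [Field L] [Algebra F[X] K]
    [Algebra F K] [IsScalarTower F F[X] K] [Algebra.IsAlgebraic F[X] K]
    [Algebra F[X] L] [IsFractionRing F[X] L] [Algebra F L] [IsScalarTower F F[X] L]
    [Algebra L K] [IsScalarTower F[X] L K] [IsScalarTower F L K]
    [Algebra.EssFiniteType F K] {ι : Type*} (S : Finset ι) (r : ι → K) (hr : ∀ i, r i ≠ 0) :
    ∃ D : Derivation F K K, ∃ e : ι → ℤ, ∃ d : ℕ, d ≠ 0 ∧ D (algebraMap F[X] K X) = 1 ∧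
      ∀ (c : ι → F) (b : F), ∑ i ∈ S, c i • (D (r i) / r i) = b • (algebraMap F[X] K X)⁻¹ →
        ∑ i ∈ S, c i * (e i : F) = b * d := by
  have : FaithfulSMul F[X] L := IsFractionRing.instFaithfulSMul _ _
  have : Algebra.IsAlgebraic L K := (IsFractionRing.comap_isAlgebraic_iff (A := F[X])).1 ‹_›
  have : Algebra.EssFiniteType L K := Algebra.EssFiniteType.of_comp F L K
  have : FiniteDimensional L K := Algebra.finite_of_essFiniteType_of_isAlgebraic
  have : CharZero L := charZero_of_injective_algebraMap (algebraMap F L).injective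
  have : Algebra.FormallyEtale L K := Algebra.FormallyEtale.of_isSeparable L K
  have : Algebra.FormallyEtale F[X] L :=
    Algebra.FormallyEtale.of_isLocalization (nonZeroDivisors F[X])
  obtain ⟨DL, hDL⟩ := pc_ext F F[X] L ((Algebra.linearMap F[X] L).compDer (derivative' (R := F)))
  obtain ⟨DK, hDK⟩ := pc_ext F L K ((Algebra.linearMap L K).compDer DL)
  have hDL' : ∀ p : F[X], DL.restrictScalars ℤ (algebraMap F[X] L p)
      = algebraMap F[X] L (derivative p) := by
    intro p; simpa using hDL p
  have hN : ∀ i, Algebra.norm L (r i) ≠ 0 := fun i => by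
    simpa [Algebra.norm_eq_zero_iff] using hr i
  choose e he using fun i => pc_ev (F := F) (L := L) (DL.restrictScalars ℤ) hDL' (Algebra.norm L (r i)) (hN i)
  have hX : algebraMap F[X] L X ≠ 0 := by simp
  refine ⟨DK, e, Module.finrank L K, Module.finrank_pos.ne', ?_, ?_⟩
  · rw [IsScalarTower.algebraMap_apply F[X] L K, hDK]
    have := hDL X
    simp at this
    simp [this]
  · intro c b h
    have h1 := congrArg (Algebra.trace L K) h
    have htr : ∀ i, Algebra.trace L K (DK (r i) / r i)
        = DL (Algebra.norm L (r i)) / Algebra.norm L (r i) := fun i =>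
      pc_trace L K (DL.restrictScalars ℤ) (DK.restrictScalars ℤ) (fun x => by simpa using hDK x)
        (r i) (hr i)
    have hsm : ∀ (a : F) (z : K), Algebra.trace L K (a • z) = algebraMap F L a * Algebra.trace L K z := by
      intro a z
      rw [← algebraMap_smul L a z, map_smul, smul_eq_mul]
    have hinv : (algebraMap F[X] K X)⁻¹ = algebraMap L K (algebraMap F[X] L X)⁻¹ := by
      rw [IsScalarTower.algebraMap_apply F[X] L K, map_inv₀]
    simp only [map_sum, hsm, htr, hinv, Algebra.trace_algebraMap] at h1
    have h2 := congrArg (fun z => algebraMap F[X] L X * z) h1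
    have hE := PcEv.sum S _ _ (fun i _ => (he i).smul (c i))
    have hE2 : PcEv F L (algebraMap F[X] L (C (b * (Module.finrank L K : F)))) _ := PcEv.const _
    refine hE.unique (Eq.subst (motive := fun z => PcEv F L z _) ?_ hE2)
    have hC : ∀ a : F, algebraMap F[X] L (C a) = algebraMap F L a := by
      intro a
      rw [IsScalarTower.algebraMap_apply F F[X] L]; rfl
    simp only [hC, Derivation.restrictScalars_apply]
    simp only [Finset.mul_sum] at h2
    rw [map_mul]
    refine Eq.trans ?_ (h2.symm.trans ?_)
    · rw [nsmul_eq_mul, map_natCast]; field_simp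
    · refine Finset.sum_congr rfl fun i _ => ?_
      ring

open IntermediateField algebraAdjoinAdjoin in
theorem pc_tower (K : Type*) [Field K] [Algebra ℂ K] (s : K) (hs : Transcendental ℂ s) :
    ∃ F : IntermediateField ℂ K, Transcendental F s ∧
      ∀ z : K, IsAlgebraic ((Polynomial.aeval s : Polynomial F →ₐ[F] K).restrictScalars ℂ).range z := by
  have h0 : AlgebraicIndepOn ℂ id ({s} : Set K) := by
    exact (algebraicIndependent_singleton_iff (⟨s, rfl⟩ : ({s} : Set K))).2 hs
  obtain ⟨t, hst, ht⟩ := exists_isTranscendenceBasis_superset h0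
  have hsmem : s ∈ t := hst rfl
  let T : Set K := Set.image Subtype.val ({(⟨s, hsmem⟩ : t)}ᶜ : Set t)
  have h1 : Transcendental (Algebra.adjoin ℂ T) s :=
    ht.1.transcendental_adjoin (s := {(⟨s, hsmem⟩ : t)}ᶜ) (i := ⟨s, hsmem⟩) (by simp)
  refine ⟨adjoin ℂ T, ?_, ?_⟩
  · intro h2
    exact h1 ((IsFractionRing.isAlgebraic_iff (Algebra.adjoin ℂ T) (adjoin ℂ T) K).2 h2)
  · intro z
    have h3 := ht.isAlgebraic.isAlgebraic z
    set R2 := ((Polynomial.aeval s : Polynomial (adjoin ℂ T) →ₐ[adjoin ℂ T] K).restrictScalars ℂ).range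
    have hle : Algebra.adjoin ℂ (Set.range (Subtype.val : t → K)) ≤ R2 := by
      rw [Algebra.adjoin_le_iff]
      rintro _ ⟨⟨y, hy⟩, rfl⟩
      by_cases hys : y = s
      · exact ⟨Polynomial.X, by simp [hys]⟩
      · refine ⟨Polynomial.C ⟨y, subset_adjoin ℂ T ⟨⟨y, hy⟩, by simpa using hys, rfl⟩⟩, ?_⟩
        simp
    let : Algebra (Algebra.adjoin ℂ (Set.range (Subtype.val : t → K))) R2 :=
      (Subalgebra.inclusion hle).toRingHom.toAlgebra
    have : IsScalarTower (Algebra.adjoin ℂ (Set.range (Subtype.val : t → K))) R2 K :=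
      IsScalarTower.of_algebraMap_eq fun _ => rfl
    exact h3.extendScalars (S := R2) (Subalgebra.inclusion_injective hle)

theorem pc_alg (K : Type*) [Field K] [Algebra ℂ K] (s : K) (hs : IsAlgebraic ℂ s) :
    ∃ c : ℂ, s = algebraMap ℂ K c := by
  have := minpoly.mem_range_of_degree_eq_one ℂ s
    (IsAlgClosed.degree_eq_one_of_irreducible ℂ (minpoly.irreducible hs.isIntegral))
  obtain ⟨c, hc⟩ := this
  exact ⟨c, hc.symm⟩

theorem pc_dprod (K : Type*) [Field K] {R : Type*} [CommRing R] [Algebra R K]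
    (D : Derivation R K K) {ι : Type*} (S : Finset ι)
    (r : ι → K) (hr : ∀ i, r i ≠ 0) (m : ι → ℤ) :
    D (∏ i ∈ S, r i ^ m i) / (∏ i ∈ S, r i ^ m i) = ∑ i ∈ S, (m i : K) * (D (r i) / r i) := by
  classical
  induction S using Finset.induction_on with
  | empty => simp
  | insert a s ha ih =>
    rw [Finset.prod_insert ha, Finset.sum_insert ha, ← ih]
    have h1 : ∏ i ∈ s, r i ^ m i ≠ 0 := Finset.prod_ne_zero_iff.2 fun i _ => zpow_ne_zero _ (hr i)
    have h2 : r a ^ m a ≠ 0 := zpow_ne_zero _ (hr a)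
    have h3 := hr a
    rw [Derivation.leibniz, Derivation.leibniz_zpow]
    simp only [smul_eq_mul, zsmul_eq_mul]
    rw [zpow_sub_one₀ h3]
    field_simp
    ring

open Polynomial in
theorem pc_dlog (K : Type*) [Field K] [Algebra ℂ K] [Algebra.EssFiniteType ℂ K]
    {ι : Type*} (S : Finset ι) (r : ι → K) (hr : ∀ i, r i ≠ 0) (c : ι → ℂ)
    (hsum : ∀ D : Derivation ℂ K K, ∑ i ∈ S, c i • (D (r i) / r i) = 0) (m : ι → ℤ)
    (hm : ∀ e : ι → ℤ, ∑ i ∈ S, c i * (e i : ℂ) = 0 → ∑ i ∈ S, m i * e i = 0) :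
    ∃ a : ℂ, ∏ i ∈ S, r i ^ m i = algebraMap ℂ K a := by
  by_cases hs : IsAlgebraic ℂ (∏ i ∈ S, r i ^ m i)
  · exact pc_alg K _ hs
  exfalso
  set s := ∏ i ∈ S, r i ^ m i with hsdef
  obtain ⟨F, hF, hz⟩ := pc_tower K s hs
  let : Algebra F[X] K := (aeval s : F[X] →ₐ[F] K).toRingHom.toAlgebra
  have hmap : ∀ p : F[X], algebraMap F[X] K p = aeval s p := fun _ => rfl
  have : IsScalarTower F F[X] K := by
    refine IsScalarTower.of_algebraMap_eq fun x => ?_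
    rw [hmap]; simp
  have : FaithfulSMul F[X] K := by
    rw [faithfulSMul_iff_algebraMap_injective]
    exact transcendental_iff_injective.1 hF
  have : Algebra.IsAlgebraic F[X] K := by
    refine ⟨fun z => ?_⟩
    refine IsAlgebraic.of_ringHom_of_comp_eq
      ((aeval s : F[X] →ₐ[F] K).restrictScalars ℂ).rangeRestrict (RingHom.id K) (hz z)
      (AlgHom.rangeRestrict_surjective _) Function.injective_id ?_
    ext <;> rfl
  have : Algebra.EssFiniteType F K := Algebra.EssFiniteType.of_comp ℂ F K
  have : CharZero F := charZero_of_injective_algebraMap (algebraMap ℂ F).injective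
  let : Algebra (FractionRing F[X]) K := FractionRing.liftAlgebra F[X] K
  have : IsScalarTower F[X] (FractionRing F[X]) K := FractionRing.isScalarTower_liftAlgebra F[X] K
  have : IsScalarTower F (FractionRing F[X]) K := by
    refine IsScalarTower.of_algebraMap_eq fun x => ?_
    rw [IsScalarTower.algebraMap_apply F F[X] K,
      IsScalarTower.algebraMap_apply F F[X] (FractionRing F[X]),
      IsScalarTower.algebraMap_apply F[X] (FractionRing F[X]) K]
  obtain ⟨D, e, d, hd, hDX, hmain⟩ := pc_core F (FractionRing F[X]) K S r hr
  have hX : algebraMap F[X] K X = s := by rw [hmap]; simp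
  rw [hX] at hDX hmain
  have h1 := hmain (fun i => algebraMap ℂ F (c i)) 0 (by
    have := hsum (D.restrictScalars ℂ)
    simp only [algebraMap_smul, zero_smul]
    simpa using this)
  have h2 : ∑ i ∈ S, c i * (e i : ℂ) = 0 := by
    apply (algebraMap ℂ F).injective
    simpa using h1
  have h3 := hm e h2
  have h4 := hmain (fun i => (m i : F)) 1 (by
    have := pc_dprod K D S r hr m
    rw [← hsdef, hDX] at this
    rw [one_smul, ← one_div, this]
    refine Finset.sum_congr rfl fun i _ => ?_
    rw [Algebra.smul_def, map_intCast])
  have h5 : ((∑ i ∈ S, m i * e i : ℤ) : F) = d := by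
    push_cast; simpa using h4
  rw [h3] at h5
  exact hd (by exact_mod_cast h5.symm)

theorem pc_int {O K : Type*} [CommRing O] [Field K] [Algebra O K] {x y : K} (h : IsIntegral O x)
    (e : y = x) : IsIntegral O y := by rw [e]; exact h

theorem pc_den (O L K : Type*) [CommRing O] [IsDomain O] [IsDiscreteValuationRing O] [Field L] [Field K]
    [Algebra O L] [IsFractionRing O L] [Algebra L K] [Algebra O K] [IsScalarTower O L K]
    [FiniteDimensional L K] [CharZero L] (t : O) (ht : Irreducible t)
    (z : K) : ∃ k : ℕ, IsIntegral O (algebraMap O K (t ^ k) * z) := by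
  have : Algebra.IsAlgebraic O K := (IsFractionRing.comap_isAlgebraic_iff (K := L)).2 inferInstance
  obtain ⟨y, hy, h⟩ := (this.isAlgebraic z).exists_integral_multiple
  obtain ⟨k, u, rfl⟩ := IsDiscreteValuationRing.eq_unit_mul_pow_irreducible hy ht
  refine ⟨k, ?_⟩
  have h2 := h.smul (↑u⁻¹ : O)
  rw [smul_smul, ← mul_assoc, Units.inv_mul, one_mul, Algebra.smul_def] at h2
  exact h2

theorem pc_mono (O K : Type*) [CommRing O] [Field K] [Algebra O K] (t : O)
    {z : K} {k l : ℕ} (hkl : k ≤ l) (h : IsIntegral O (algebraMap O K (t ^ k) * z)) :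
    IsIntegral O (algebraMap O K (t ^ l) * z) := by
  obtain ⟨j, rfl⟩ := Nat.exists_eq_add_of_le hkl
  have := h.smul (t ^ j)
  rw [Algebra.smul_def, ← mul_assoc, ← map_mul, ← pow_add, add_comm] at this
  exact this

theorem pc_dvr (O L K : Type*) [CommRing O] [IsDomain O] [IsDiscreteValuationRing O] [Field L] [Field K]
    [Algebra O L] [IsFractionRing O L] [Algebra L K] [Algebra O K] [IsScalarTower O L K]
    [FiniteDimensional L K] [CharZero L] (t : O) (ht : Irreducible t)
    (δ : Derivation ℤ K K) (N : ℕ)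
    (hN : ∀ o : O, IsIntegral O (algebraMap O K (t ^ N) * δ (algebraMap O K o))) :
    ∃ M : ℕ, ∀ r : K, r ≠ 0 → IsIntegral O (algebraMap O K (t ^ M) * (δ r / r)) := by
  classical
  let B := integralClosure O K
  have : IsDedekindDomain B := IsIntegralClosure.isDedekindDomain O L K B
  have hfin : Module.Finite O B := IsIntegralClosure.finite O L K B
  have hinjOK : Function.Injective (algebraMap O K) := by
    rw [IsScalarTower.algebraMap_eq O L K]
    exact (algebraMap L K).injective.comp (IsFractionRing.injective O L)
  have : FaithfulSMul O K := (faithfulSMul_iff_algebraMap_injective O K).2 hinjOK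
  have hIntg : Algebra.IsIntegral O B := inferInstance
  have hmax : ∀ I : Ideal B, I.IsMaximal → I.comap (algebraMap O B) = IsLocalRing.maximalIdeal O := by
    intro I hI
    exact IsLocalRing.eq_maximalIdeal (Ideal.isMaximal_comap_of_isIntegral_of_isMaximal I)
  have : Module.IsTorsionFree O B := inferInstance
  have : IsPrincipalIdealRing B := by
    apply IsPrincipalIdealRing.of_finite_maximals
    refine (IsDedekindDomain.primesOver_finite (IsLocalRing.maximalIdeal O) B).subset ?_
    intro I hI
    exact ⟨hI.isPrime, ⟨(hmax I hI).symm⟩⟩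
  obtain ⟨G, hG⟩ := hfin.fg_top
  choose kk hkk using fun g : B => pc_den O L K t ht (δ (g : K))
  let M1 := N + ∑ g ∈ G, kk g
  have hB : ∀ b : B, IsIntegral O (algebraMap O K (t ^ M1) * δ (b : K)) := by
    intro b
    have hb : b ∈ Submodule.span O (G : Set B) := by rw [hG]; trivial
    induction hb using Submodule.span_induction with
    | mem g hg =>
      refine pc_mono O K t ?_ (hkk g)
      exact (Finset.single_le_sum (f := kk) (fun _ _ => Nat.zero_le _) hg).trans (Nat.le_add_left _ _)
    | zero => simpa using isIntegral_zero
    | add x y _ _ hx hy =>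
      have := hx.add hy
      rw [← mul_add, ← map_add] at this
      exact this
    | smul o x _ hx =>
      have h1 := hx.smul o
      have hNM : N ≤ M1 := Nat.le_add_right _ _
      have h2 := (pc_mono O K t hNM (hN o)).mul x.2
      have h3 := h1.add h2
      refine pc_int h3 ?_
      have h4 : ((o • x : B) : K) = algebraMap O K o * x := by rw [← Algebra.smul_def]; rfl
      rw [h4, Derivation.leibniz, smul_eq_mul, smul_eq_mul, Algebra.smul_def]
      ring
  have hprime : ∀ p : B, Prime p → p ∣ algebraMap O B t := by
    intro p hp
    have h1 : (Ideal.span {p}).IsPrime := (Ideal.span_singleton_prime hp.ne_zero).2 hp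
    have h2 : (Ideal.span {p}).IsMaximal := h1.isMaximal (by simpa using hp.ne_zero)
    have h3 : t ∈ (Ideal.span {p}).comap (algebraMap O B) := by
      rw [hmax _ h2]
      exact (IsLocalRing.mem_maximalIdeal _).2 ht.not_isUnit
    exact Ideal.mem_span_singleton.1 h3
  have hlog : ∀ b : B, b ≠ 0 → IsIntegral O (algebraMap O K (t ^ (M1 + 1)) * (δ (b : K) / b)) := by
    intro b
    induction b using UniqueFactorizationMonoid.induction_on_prime with
    | h₁ => intro h; exact absurd rfl h
    | h₂ x hx =>
      intro _
      obtain ⟨u, rfl⟩ := hx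
      refine pc_mono O K t (Nat.le_succ _) ?_
      have h1 := (hB u).mul (↑u⁻¹ : B).2
      have h2 : ((u : B) : K) * ((↑u⁻¹ : B) : K) = 1 := by
        rw [← Subalgebra.coe_mul, Units.mul_inv]; rfl
      rw [div_eq_mul_inv, ← eq_inv_of_mul_eq_one_right h2, ← mul_assoc]
      exact h1
    | h₃ a p ha hp ih =>
      intro _
      have h1 := ih ha
      have hp0 : (p : K) ≠ 0 := by simpa using hp.ne_zero
      have ha0 : (a : K) ≠ 0 := by simpa using ha
      obtain ⟨q, hq⟩ := hprime p hp
      have hq' : algebraMap O K t = p * q := by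
        have := congrArg (Subtype.val) hq
        simpa using this
      have h2 := (hB p).mul q.2
      have h3 := h2.add h1
      refine pc_int h3 ?_
      rw [pow_succ, map_mul, hq']
      simp only [Subalgebra.coe_mul, Derivation.leibniz, smul_eq_mul]
      field_simp
      ring
  refine ⟨M1 + 1, fun r hr => ?_⟩
  obtain ⟨k, hk⟩ := pc_den O L K t ht r
  have ht0 : algebraMap O K t ≠ 0 := by
    rw [Ne, map_eq_zero_iff _ hinjOK]; exact ht.ne_zero
  let b : B := ⟨_, hk⟩
  have hb0 : b ≠ 0 := by
    intro h
    have := congrArg Subtype.val h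
    simp [b, ht0, hr] at this
  have htB : algebraMap O B t ≠ 0 := by
    intro h
    have := congrArg Subtype.val h
    exact ht0 (by simpa using this)
  have h1 := hlog b hb0
  have h2 := hlog (algebraMap O B t) htB
  have h3 := h1.sub (h2.smul (k : O))
  refine pc_int h3 ?_
  have hpow : δ (algebraMap O K t ^ k) / algebraMap O K t ^ k
      = (k : K) * (δ (algebraMap O K t) / algebraMap O K t) := by
    rw [Derivation.leibniz_pow]
    rcases k with _ | k
    · simp
    · simp [pow_succ]; field_simp
  have hz : δ (b : K) / (b : K) = δ (algebraMap O K t ^ k) / algebraMap O K t ^ k + δ r / r := by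
    simp only [b, map_pow, Derivation.leibniz, smul_eq_mul]
    field_simp
    ring
  rw [hz, hpow, Algebra.smul_def, map_natCast]
  have h5 : ((algebraMap O B t : B) : K) = algebraMap O K t := rfl
  rw [h5]
  ring

theorem pc_deg_key (n : ℕ) (L : Type*) [Field L] [Algebra (MvPolynomial (Fin n) ℂ) L]
    [IsFractionRing (MvPolynomial (Fin n) ℂ) L] {z : L} {f g f' g' : MvPolynomial (Fin n) ℂ}
    (hg : g ≠ 0) (hg' : g' ≠ 0) 
    (h : z * algebraMap _ L g = algebraMap _ L f) (h' : z * algebraMap _ L g' = algebraMap _ L f')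
    (hd : f'.totalDegree ≤ g'.totalDegree) : f.totalDegree ≤ g.totalDegree := by
  by_cases hf : f = 0
  · simp [hf]
  have e : f * g' = f' * g := by
    apply IsFractionRing.injective (MvPolynomial (Fin n) ℂ) L
    rw [map_mul, map_mul, ← h, ← h']; ring
  have hf' : f' ≠ 0 := by
    rintro rfl
    simp [hf, hg'] at e
  have := congrArg MvPolynomial.totalDegree e
  rw [MvPolynomial.totalDegree_mul_of_isDomain hf hg', MvPolynomial.totalDegree_mul_of_isDomain hf' hg] at this
  omega

/-- The valuation ring of the degree valuation on rational functions. -/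
def pcO (n : ℕ) (L : Type*) [Field L] [Algebra (MvPolynomial (Fin n) ℂ) L]
    [IsFractionRing (MvPolynomial (Fin n) ℂ) L] : ValuationSubring L where
  carrier := {z | ∃ f g : MvPolynomial (Fin n) ℂ, g ≠ 0 ∧ z * algebraMap _ L g = algebraMap _ L f ∧
    f.totalDegree ≤ g.totalDegree}
  zero_mem' := ⟨0, 1, one_ne_zero, by simp, by simp⟩
  one_mem' := ⟨1, 1, one_ne_zero, by simp, by simp⟩
  add_mem' := by
    rintro z w ⟨f, g, hg, h, hd⟩ ⟨f', g', hg', h', hd'⟩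
    refine ⟨f * g' + f' * g, g * g', mul_ne_zero hg hg', ?_, ?_⟩
    · rw [map_add, map_mul, map_mul, map_mul, ← h, ← h']; ring
    · rw [MvPolynomial.totalDegree_mul_of_isDomain hg hg']
      refine (MvPolynomial.totalDegree_add _ _).trans (max_le ?_ ?_)
      · refine (MvPolynomial.totalDegree_mul _ _).trans (by omega)
      · refine (MvPolynomial.totalDegree_mul _ _).trans (by omega)
  mul_mem' := by
    rintro z w ⟨f, g, hg, h, hd⟩ ⟨f', g', hg', h', hd'⟩
    refine ⟨f * f', g * g', mul_ne_zero hg hg', ?_, ?_⟩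
    · rw [map_mul, map_mul, ← h, ← h']; ring
    · rw [MvPolynomial.totalDegree_mul_of_isDomain hg hg']
      refine (MvPolynomial.totalDegree_mul _ _).trans (by omega)
  neg_mem' := by
    rintro z ⟨f, g, hg, h, hd⟩
    exact ⟨-f, g, hg, by rw [map_neg, ← h]; ring, by rwa [MvPolynomial.totalDegree_neg]⟩
  mem_or_inv_mem' := by
    intro z
    obtain ⟨f, g, hg, rfl⟩ := IsFractionRing.div_surjective (A := MvPolynomial (Fin n) ℂ) z
    have hg : g ≠ 0 := nonZeroDivisors.ne_zero hg
    have hgL : algebraMap _ L g ≠ 0 := by simpa using hg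
    by_cases hf : f = 0
    · left
      exact ⟨0, 1, one_ne_zero, by simp [hf], by simp⟩
    have hfL : algebraMap _ L f ≠ 0 := by simpa using hf
    rcases le_total f.totalDegree g.totalDegree with h | h
    · left
      exact ⟨f, g, hg, by field_simp, h⟩
    · right
      exact ⟨g, f, hf, by field_simp, h⟩

theorem pcO_mem (n : ℕ) (L : Type*) [Field L] [Algebra (MvPolynomial (Fin n) ℂ) L]
    [IsFractionRing (MvPolynomial (Fin n) ℂ) L] (z : L) : z ∈ pcO n L ↔
    ∃ f g : MvPolynomial (Fin n) ℂ, g ≠ 0 ∧ z * algebraMap _ L g = algebraMap _ L f ∧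
    f.totalDegree ≤ g.totalDegree := Iff.rfl

theorem pcO_unit (n : ℕ) (L : Type*) [Field L] [Algebra (MvPolynomial (Fin n) ℂ) L]
    [IsFractionRing (MvPolynomial (Fin n) ℂ) L] (z : pcO n L) (f g : MvPolynomial (Fin n) ℂ)
    (hf : f ≠ 0) (hg : g ≠ 0) (h : (z : L) * algebraMap _ L g = algebraMap _ L f)
    (hd : f.totalDegree = g.totalDegree) : IsUnit z := by
  have hfL : algebraMap _ L f ≠ 0 := by simpa using hf
  have hgL : algebraMap _ L g ≠ 0 := by simpa using hg
  have hz : (z : L) ≠ 0 := by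
    intro h0; rw [h0, zero_mul] at h; exact hfL h.symm
  refine IsUnit.of_mul_eq_one (⟨(z : L)⁻¹, g, f, hf, ?_, hd.ge⟩ : pcO n L) ?_
  · rw [← h]; field_simp
  · apply Subtype.ext
    simp [hz]

/-- The uniformizer. -/
noncomputable def pcT (n : ℕ) (L : Type*) [Field L] [Algebra (MvPolynomial (Fin n) ℂ) L]
    [IsFractionRing (MvPolynomial (Fin n) ℂ) L] (i : Fin n) : pcO n L :=
  ⟨(algebraMap _ L (MvPolynomial.X i : MvPolynomial (Fin n) ℂ))⁻¹, 1, MvPolynomial.X i,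
    MvPolynomial.X_ne_zero i, by
      rw [map_one]
      exact inv_mul_cancel₀ (by simp), by simp⟩

theorem pcT_mul (n : ℕ) (L : Type*) [Field L] [Algebra (MvPolynomial (Fin n) ℂ) L]
    [IsFractionRing (MvPolynomial (Fin n) ℂ) L] (i : Fin n) :
    (pcT n L i : L) * algebraMap _ L (MvPolynomial.X i : MvPolynomial (Fin n) ℂ) = 1 :=
  inv_mul_cancel₀ (by simp)

theorem pcT_deg (n : ℕ) (L : Type*) [Field L] [Algebra (MvPolynomial (Fin n) ℂ) L]
    [IsFractionRing (MvPolynomial (Fin n) ℂ) L] (i : Fin n) (N : ℕ) (p : MvPolynomial (Fin n) ℂ)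
    (h : (pcT n L i : L) ^ N * algebraMap _ L p ∈ pcO n L) : p.totalDegree ≤ N := by
  obtain ⟨f, g, hg, h1, hd⟩ := h
  have h2 : ((pcT n L i : L) ^ N * algebraMap _ L p) *
      algebraMap _ L ((MvPolynomial.X i : MvPolynomial (Fin n) ℂ) ^ N) = algebraMap _ L p := by
    rw [map_pow]
    calc _ = ((pcT n L i : L) * algebraMap _ L (MvPolynomial.X i : MvPolynomial (Fin n) ℂ)) ^ N *
        algebraMap _ L p := by ring
      _ = _ := by rw [pcT_mul]; simp
  have := pc_deg_key n L (pow_ne_zero N (MvPolynomial.X_ne_zero i)) hg h2 h1 hd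
  simpa [MvPolynomial.totalDegree_X_pow] using this

theorem pcT_irr (n : ℕ) (L : Type*) [Field L] [Algebra (MvPolynomial (Fin n) ℂ) L]
    [IsFractionRing (MvPolynomial (Fin n) ℂ) L] (i : Fin n) : Irreducible (pcT n L i) := by
  constructor
  · rintro ⟨u, hu⟩
    have h1 : ((↑u⁻¹ : pcO n L) : L) = algebraMap _ L (MvPolynomial.X i : MvPolynomial (Fin n) ℂ) := by
      have h2 : (u : pcO n L) * (↑u⁻¹ : pcO n L) = 1 := Units.mul_inv u
      have h3 := congrArg Subtype.val h2
      rw [hu] at h3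
      have h4 := pcT_mul n L i
      have h5 : (pcT n L i : L) ≠ 0 := left_ne_zero_of_mul_eq_one h4
      exact mul_left_cancel₀ h5 (h3.trans h4.symm)
    have h2 := pcT_deg n L i 0 (MvPolynomial.X i) (by
      rw [pow_zero, one_mul, ← h1]; exact (↑u⁻¹ : pcO n L).2)
    simp at h2
  · rintro ⟨a, f, g, hg, h, hd⟩ ⟨b, f', g', hg', h', hd'⟩ hab
    have hab := congrArg Subtype.val hab
    change (pcT n L i : L) = a * b at hab
    have e : MvPolynomial.X i * (f * f') = g * g' := by
      apply IsFractionRing.injective (MvPolynomial (Fin n) ℂ) L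
      rw [map_mul, map_mul, map_mul, ← h, ← h']
      calc _ = (a * b * algebraMap _ L (MvPolynomial.X i : MvPolynomial (Fin n) ℂ)) *
            (algebraMap _ L g * algebraMap _ L g') := by ring
        _ = _ := by rw [← hab, pcT_mul, one_mul]
    have hf : f ≠ 0 := by rintro rfl; simp [hg, hg'] at e
    have hf' : f' ≠ 0 := by rintro rfl; simp [hg, hg'] at e
    have e2 := congrArg MvPolynomial.totalDegree e
    rw [MvPolynomial.totalDegree_mul_of_isDomain (MvPolynomial.X_ne_zero i) (mul_ne_zero hf hf'),
      MvPolynomial.totalDegree_mul_of_isDomain hf hf', MvPolynomial.totalDegree_mul_of_isDomain hg hg',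
      MvPolynomial.totalDegree_X] at e2
    by_cases hh : f.totalDegree = g.totalDegree
    · left; exact pcO_unit n L _ f g hf hg h hh
    · right; exact pcO_unit n L _ f' g' hf' hg' h' (by omega)

theorem pcO_dvr (n : ℕ) (L : Type*) [Field L] [Algebra (MvPolynomial (Fin n) ℂ) L]
    [IsFractionRing (MvPolynomial (Fin n) ℂ) L] (i : Fin n) : IsDiscreteValuationRing (pcO n L) := by
  apply IsDiscreteValuationRing.ofHasUnitMulPowIrreducibleFactorization
  refine ⟨pcT n L i, pcT_irr n L i, ?_⟩
  rintro ⟨z, f, g, hg, h, hd⟩ hz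
  have hz0 : z ≠ 0 := fun h0 => hz (Subtype.ext h0)
  have hgL : algebraMap _ L g ≠ 0 := by simpa using hg
  have hf : f ≠ 0 := by
    rintro rfl
    simp only [map_zero, mul_eq_zero, hz0, hgL, or_self] at h
  refine ⟨g.totalDegree - f.totalDegree, ?_⟩
  set k := g.totalDegree - f.totalDegree with hk
  have hX := MvPolynomial.X_ne_zero (R := ℂ) i
  have hdd : (f * MvPolynomial.X i ^ k).totalDegree = g.totalDegree := by
    rw [MvPolynomial.totalDegree_mul_of_isDomain hf (pow_ne_zero k hX), MvPolynomial.totalDegree_X_pow]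
    omega
  have hw : z * algebraMap _ L (MvPolynomial.X i : MvPolynomial (Fin n) ℂ) ^ k * algebraMap _ L g
      = algebraMap _ L (f * MvPolynomial.X i ^ k) := by
    rw [map_mul, map_pow, ← h]; ring
  let w : pcO n L := ⟨z * algebraMap _ L (MvPolynomial.X i : MvPolynomial (Fin n) ℂ) ^ k,
    f * MvPolynomial.X i ^ k, g, hg, hw, hdd.le⟩
  obtain ⟨u, hu⟩ := pcO_unit n L w _ g (mul_ne_zero hf (pow_ne_zero k hX)) hg hw hdd
  refine ⟨u, ?_⟩
  rw [hu]
  apply Subtype.ext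
  change (pcT n L i : L) ^ k * (z * algebraMap _ L (MvPolynomial.X i : MvPolynomial (Fin n) ℂ) ^ k) = z
  calc _ = ((pcT n L i : L) * algebraMap _ L (MvPolynomial.X i : MvPolynomial (Fin n) ℂ)) ^ k * z := by ring
    _ = z := by rw [pcT_mul]; simp

theorem pc_pderiv_deg (n : ℕ) (i : Fin n) (f : MvPolynomial (Fin n) ℂ) :
    (MvPolynomial.pderiv i f).totalDegree ≤ f.totalDegree := by
  refine Finset.sup_le fun s hs => ?_
  rw [MvPolynomial.mem_support_iff, MvPolynomial.coeff_pderiv] at hs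
  have h1 := left_ne_zero_of_mul hs
  have h2 := MvPolynomial.le_totalDegree (MvPolynomial.mem_support_iff.2 h1)
  refine le_trans ?_ h2
  rw [Finsupp.sum_add_index' (by simp) (by simp)]
  omega

theorem pc_chain (n : ℕ) (K : Type*) [Field K] [Algebra ℂ K] [Algebra (MvPolynomial (Fin n) ℂ) K]
    [IsScalarTower ℂ (MvPolynomial (Fin n) ℂ) K] (δ : Derivation ℂ K K) (f : MvPolynomial (Fin n) ℂ) :
    δ (algebraMap _ K f) = ∑ i, algebraMap _ K (MvPolynomial.pderiv i f) *
      δ (algebraMap _ K (MvPolynomial.X i : MvPolynomial (Fin n) ℂ)) := by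
  classical
  induction f using MvPolynomial.induction_on with
  | C a =>
    rw [← MvPolynomial.algebraMap_eq, ← IsScalarTower.algebraMap_apply]
    simp
  | add p q hp hq =>
    simp only [map_add, hp, hq, add_mul, Finset.sum_add_distrib]
  | mul_X p j hp =>
    rw [map_mul, Derivation.leibniz, hp]
    simp only [Derivation.leibniz, smul_eq_mul, map_add, map_mul, MvPolynomial.pderiv_X, add_mul,
      Finset.sum_add_distrib, Finset.mul_sum]
    congr 1
    · rw [Finset.sum_eq_single j]
      · simp
      · intro b _ hb; simp [Pi.single_apply, hb.symm]
      · simp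
    · refine Finset.sum_congr rfl fun i _ => by ring

theorem pc_N (n : ℕ) (i0 : Fin n) (L K : Type*) [Field L] [Field K] [CharZero L]
    [Algebra (MvPolynomial (Fin n) ℂ) L] [IsFractionRing (MvPolynomial (Fin n) ℂ) L]
    [Algebra L K] [FiniteDimensional L K] [Algebra (MvPolynomial (Fin n) ℂ) K]
    [IsScalarTower (MvPolynomial (Fin n) ℂ) L K] [Algebra ℂ K]
    [IsScalarTower ℂ (MvPolynomial (Fin n) ℂ) K] (δ : Derivation ℂ K K) :
    ∃ N : ℕ, ∀ o : pcO n L, IsIntegral (pcO n L)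
      (algebraMap (pcO n L) K (pcT n L i0 ^ N) * δ (algebraMap (pcO n L) K o)) := by
  have := pcO_dvr n L i0
  choose k hk using fun i : Fin n => pc_den (pcO n L) L K (pcT n L i0) (pcT_irr n L i0)
    (δ (algebraMap _ K (MvPolynomial.X i : MvPolynomial (Fin n) ℂ)))
  refine ⟨∑ i, k i, ?_⟩
  rintro ⟨z, hz⟩
  obtain ⟨f, g, hg, h, hd⟩ := (pcO_mem n L z).1 hz
  have hgL : algebraMap _ L g ≠ 0 := by simpa using hg
  have hmem : ∀ i, (algebraMap _ L (MvPolynomial.pderiv i f) -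
      z * algebraMap _ L (MvPolynomial.pderiv i g)) / algebraMap _ L g ∈ pcO n L := by
    intro i
    refine ⟨MvPolynomial.pderiv i f * g - f * MvPolynomial.pderiv i g, g * g, mul_ne_zero hg hg, ?_, ?_⟩
    · rw [map_sub, map_mul, map_mul, map_mul, ← h]
      field_simp
    · rw [MvPolynomial.totalDegree_mul_of_isDomain hg hg]
      have h1 := pc_pderiv_deg n i f
      have h2 := pc_pderiv_deg n i g
      refine (MvPolynomial.totalDegree_sub _ _).trans (max_le ?_ ?_)
      · exact (MvPolynomial.totalDegree_mul _ _).trans (by omega)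
      · exact (MvPolynomial.totalDegree_mul _ _).trans (by omega)
  have hgK : algebraMap _ K g ≠ 0 := by
    rw [IsScalarTower.algebraMap_apply (MvPolynomial (Fin n) ℂ) L K]
    simpa using hgL
  have hK : algebraMap L K z * algebraMap _ K g = algebraMap _ K f := by
    rw [IsScalarTower.algebraMap_apply (MvPolynomial (Fin n) ℂ) L K, ← map_mul, h,
      ← IsScalarTower.algebraMap_apply (MvPolynomial (Fin n) ℂ) L K]
  have hδ : δ (algebraMap L K z) = ∑ i, algebraMap L K ((algebraMap _ L (MvPolynomial.pderiv i f) -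
      z * algebraMap _ L (MvPolynomial.pderiv i g)) / algebraMap _ L g) *
      δ (algebraMap _ K (MvPolynomial.X i : MvPolynomial (Fin n) ℂ)) := by
    have h1 := congrArg δ hK
    rw [Derivation.leibniz, smul_eq_mul, smul_eq_mul, pc_chain n K δ f, pc_chain n K δ g] at h1
    apply mul_left_cancel₀ hgK
    rw [← eq_sub_iff_add_eq'] at h1
    rw [h1, Finset.mul_sum, Finset.mul_sum, ← Finset.sum_sub_distrib]
    refine Finset.sum_congr rfl fun i _ => ?_
    rw [map_div₀, map_sub, map_mul]
    simp only [← IsScalarTower.algebraMap_apply (MvPolynomial (Fin n) ℂ) L K]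
    field_simp
  have h2 : IsIntegral (pcO n L) (∑ i, (⟨_, hmem i⟩ : pcO n L) •
      (algebraMap (pcO n L) K (pcT n L i0 ^ (∑ i, k i)) *
        δ (algebraMap _ K (MvPolynomial.X i : MvPolynomial (Fin n) ℂ)))) := by
    refine IsIntegral.sum _ fun i _ => IsIntegral.smul _ ?_
    exact pc_mono _ K _ (Finset.single_le_sum (f := k) (fun _ _ => Nat.zero_le _) (Finset.mem_univ i)) (hk i)
  refine pc_int h2 ?_
  have h3 : ∀ o : pcO n L, algebraMap (pcO n L) K o = algebraMap L K (o : L) := fun o => rfl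
  rw [h3 ⟨z, _⟩, hδ, Finset.mul_sum]
  refine Finset.sum_congr rfl fun i _ => ?_
  rw [Algebra.smul_def, h3 ⟨_, hmem i⟩]
  ring

theorem pc_bound' (n : ℕ) (i0 : Fin n) (L K : Type*) [Field L] [Field K] [CharZero L] [Algebra ℂ L]
    [Algebra (MvPolynomial (Fin n) ℂ) L] [IsFractionRing (MvPolynomial (Fin n) ℂ) L]
    [IsScalarTower ℂ (MvPolynomial (Fin n) ℂ) L]
    [Algebra L K] [FiniteDimensional L K] [Algebra (MvPolynomial (Fin n) ℂ) K]
    [IsScalarTower (MvPolynomial (Fin n) ℂ) L K] [Algebra ℂ K] [IsScalarTower ℂ L K]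
    [IsScalarTower ℂ (MvPolynomial (Fin n) ℂ) K] (δ : Derivation ℂ K K) :
    ∃ W : Submodule ℂ K, Module.Finite ℂ W ∧ ∀ r : K, r ≠ 0 →
      IsIntegral (MvPolynomial (Fin n) ℂ) (δ r / r) → δ r / r ∈ W := by
  classical
  have := pcO_dvr n L i0
  obtain ⟨N, hN⟩ := pc_N n i0 L K δ
  obtain ⟨M, hM⟩ := pc_dvr (pcO n L) L K (pcT n L i0) (pcT_irr n L i0) (δ.restrictScalars ℤ) N hN
  obtain ⟨s, b, hb⟩ := FiniteDimensional.exists_is_basis_integral (MvPolynomial (Fin n) ℂ) L K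
  choose k hk using fun i : s => pc_den (pcO n L) L K (pcT n L i0) (pcT_irr n L i0) (b i)
  let N' := M + ∑ i, k i
  let T : K →ₗ[ℂ] (s → L) := LinearMap.pi fun i =>
    ((Algebra.trace L K).restrictScalars ℂ) ∘ₗ (LinearMap.mulRight ℂ (b i))
  let U : (s → MvPolynomial.restrictTotalDegree (Fin n) ℂ N') →ₗ[ℂ] (s → L) := LinearMap.pi fun i =>
    ((Algebra.linearMap (MvPolynomial (Fin n) ℂ) L).restrictScalars ℂ) ∘ₗ
      (MvPolynomial.restrictTotalDegree (Fin n) ℂ N').subtype ∘ₗ LinearMap.proj i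
  have hT : Function.Injective T := by
    rw [← LinearMap.ker_eq_bot, LinearMap.ker_eq_bot']
    intro a ha
    have h1 : ∀ i, Algebra.trace L K (a * b i) = 0 := fun i => congrFun ha i
    have h2 : ∀ c, Algebra.traceForm L K a c = 0 := by
      intro c
      have : Algebra.traceForm L K a = 0 := b.ext fun i => by simpa using h1 i
      rw [this]; rfl
    exact (traceForm_nondegenerate L K).1 a h2
  refine ⟨(LinearMap.range U).comap T, ?_, ?_⟩
  · let T' : (LinearMap.range U).comap T →ₗ[ℂ] LinearMap.range U :=
      T.restrict (fun x hx => hx)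
    refine Module.Finite.of_injective T' ?_
    intro x y hxy
    exact Subtype.ext (hT (congrArg Subtype.val hxy))
  · intro r hr hIntg
    have hMr := hM r hr
    have hp : ∀ i, ∃ p : MvPolynomial (Fin n) ℂ, algebraMap _ L p = Algebra.trace L K (δ r / r * b i) := by
      intro i
      exact IsIntegrallyClosed.isIntegral_iff.1 (Algebra.isIntegral_trace (hIntg.mul (hb i)))
    choose p hp using hp
    have hdeg : ∀ i, (p i).totalDegree ≤ N' := by
      intro i
      have h1 := hMr.mul (hk i)
      have h2 : IsIntegral (pcO n L) (Algebra.trace L K ((pcT n L i0 : L) ^ (M + k i) • (δ r / r * b i))) := by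
        apply Algebra.isIntegral_trace
        refine pc_int h1 ?_
        have h3 : ∀ o : pcO n L, algebraMap (pcO n L) K o = algebraMap L K (o : L) := fun o => rfl
        rw [map_pow, map_pow, h3, Algebra.smul_def, map_pow, pow_add]
        change _ = _ * (δ r / r) * _
        ring
      rw [map_smul, ← hp] at h2
      obtain ⟨o, ho⟩ := IsIntegrallyClosed.isIntegral_iff.1 h2
      have h4 := pcT_deg n L i0 (M + k i) (p i) (by
        rw [← smul_eq_mul, ← ho]; exact o.2)
      refine h4.trans (Nat.add_le_add_left ?_ _)
      exact Finset.single_le_sum (f := k) (fun _ _ => Nat.zero_le _) (Finset.mem_univ i)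
    refine ⟨fun i => ⟨p i, ?_⟩, ?_⟩
    · rw [MvPolynomial.mem_restrictTotalDegree]; exact hdeg i
    · funext i
      exact hp i

theorem pc_bound (A K : Type*) [CommRing A] [IsDomain A] [Algebra ℂ A] [Algebra.FiniteType ℂ A]
    [Field K] [Algebra ℂ K] [Algebra A K] [IsScalarTower ℂ A K] [IsFractionRing A K]
    (δ : Derivation ℂ K K) :
    ∃ W : Submodule ℂ K, Module.Finite ℂ W ∧ ∀ r : K, r ≠ 0 →
      (∃ a : A, δ r / r = algebraMap A K a) → δ r / r ∈ W := by
  obtain ⟨n, g, hg, hgi⟩ := exists_integral_inj_algHom_of_fg ℂ A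
  let _ : Algebra (MvPolynomial (Fin n) ℂ) A := g.toRingHom.toAlgebra
  have : IsScalarTower ℂ (MvPolynomial (Fin n) ℂ) A := IsScalarTower.of_algebraMap_eq fun x => (g.commutes x).symm
  have : Algebra.IsIntegral (MvPolynomial (Fin n) ℂ) A := ⟨hgi⟩
  rcases n with _ | n
  · have : Algebra.IsIntegral ℂ (MvPolynomial (Fin 0) ℂ) := ⟨fun x => by
      obtain ⟨c, rfl⟩ := MvPolynomial.C_surjective (Fin 0) x
      exact isIntegral_algebraMap⟩
    have : Algebra.IsIntegral ℂ A := Algebra.IsIntegral.trans (MvPolynomial (Fin 0) ℂ)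
    have : Module.Finite ℂ A := Algebra.IsIntegral.finite
    refine ⟨LinearMap.range ((Algebra.linearMap A K).restrictScalars ℂ), inferInstance, ?_⟩
    rintro r hr ⟨a, ha⟩
    exact ⟨a, ha.symm⟩
  · let _ : Algebra (MvPolynomial (Fin (n+1)) ℂ) K := ((algebraMap A K).comp (algebraMap _ A)).toAlgebra
    have t1 : IsScalarTower (MvPolynomial (Fin (n+1)) ℂ) A K := IsScalarTower.of_algebraMap_eq fun x => rfl
    have t2 : IsScalarTower ℂ (MvPolynomial (Fin (n+1)) ℂ) K := IsScalarTower.of_algebraMap_eq fun x => by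
      rw [IsScalarTower.algebraMap_apply (MvPolynomial (Fin (n+1)) ℂ) A K,
        ← IsScalarTower.algebraMap_apply ℂ (MvPolynomial (Fin (n+1)) ℂ) A,
        ← IsScalarTower.algebraMap_apply ℂ A K]
    have inj : Function.Injective (algebraMap (MvPolynomial (Fin (n+1)) ℂ) K) :=
      (IsFractionRing.injective A K).comp hg
    have : FaithfulSMul (MvPolynomial (Fin (n+1)) ℂ) K := (faithfulSMul_iff_algebraMap_injective _ _).2 inj
    let L := FractionRing (MvPolynomial (Fin (n+1)) ℂ)
    let _ : Algebra L K := FractionRing.liftAlgebra _ K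
    have t3 : IsScalarTower (MvPolynomial (Fin (n+1)) ℂ) L K := inferInstance
    have t4 : IsScalarTower ℂ L K := IsScalarTower.of_algebraMap_eq fun x => by
      rw [IsScalarTower.algebraMap_apply ℂ (MvPolynomial (Fin (n+1)) ℂ) K,
        IsScalarTower.algebraMap_apply (MvPolynomial (Fin (n+1)) ℂ) L K,
        ← IsScalarTower.algebraMap_apply ℂ (MvPolynomial (Fin (n+1)) ℂ) L]
    have : Algebra.IsAlgebraic L K :=
      isAlgebraic_of_isFractionRing (MvPolynomial (Fin (n+1)) ℂ) A L K
    have : Algebra.EssFiniteType ℂ K := by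
      have : Algebra.EssFiniteType A K := .of_isLocalization _ (nonZeroDivisors A)
      exact .comp ℂ A K
    have : Algebra.EssFiniteType L K := Algebra.EssFiniteType.of_comp ℂ L K
    have : FiniteDimensional L K := Algebra.finite_of_essFiniteType_of_isAlgebraic
    have : CharZero L := charZero_of_injective_algebraMap (algebraMap ℂ L).injective
    obtain ⟨W, hW, h⟩ := pc_bound' (n+1) 0 L K δ
    refine ⟨W, hW, ?_⟩
    rintro r hr ⟨a, ha⟩
    refine h r hr ?_
    rw [ha]
    exact (Algebra.IsIntegral.isIntegral a).map (IsScalarTower.toAlgHom (MvPolynomial (Fin (n+1)) ℂ) A K)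

theorem pc_inj (K : Type*) [Field K] [Algebra ℂ K] [Algebra.EssFiniteType ℂ K]
    (r : ℕ → K) (hr : ∀ i, r i ≠ 0)
    (hfree : ∀ (a b : ℕ →₀ ℕ) (lam : ℂˣ),
      (a.prod fun i e => r i ^ e) = algebraMap ℂ K (lam : ℂ) * (b.prod fun i e => r i ^ e) →
      a = b) (c : ℕ →₀ ℂ)
    (hc : ∀ D : Derivation ℂ K K, ∑ i ∈ c.support, c i • (D (r i) / r i) = 0) : c = 0 := by
  classical
  by_contra hne
  obtain ⟨i0, hi0⟩ := Finsupp.ne_iff.1 hne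
  simp only [Finsupp.coe_zero, Pi.zero_apply] at hi0
  obtain ⟨φ, hφ⟩ : ∃ φ : Module.Dual ℚ ℂ, φ (c i0) ≠ 0 := by
    by_contra! h
    exact hi0 ((Module.forall_dual_apply_eq_zero_iff ℚ (c i0)).1 h)
  obtain ⟨b, hb⟩ := IsLocalization.exist_integer_multiples (nonZeroDivisors ℤ) c.support
    (fun i => φ (c i))
  have hb0 : ((b : ℤ) : ℚ) ≠ 0 := by exact_mod_cast nonZeroDivisors.ne_zero b.2
  have hm : ∀ i, ∃ z : ℤ, (z : ℚ) = (b : ℤ) * φ (c i) := by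
    intro i
    by_cases hi : i ∈ c.support
    · obtain ⟨z, hz⟩ := hb i hi
      refine ⟨z, ?_⟩
      rw [eq_intCast] at hz
      rw [hz]
      simp [Algebra.smul_def]
    · refine ⟨0, ?_⟩
      rw [Finsupp.notMem_support_iff.1 hi]; simp
  choose m hm using hm
  obtain ⟨a, ha⟩ := pc_dlog K c.support r hr c hc m (by
    intro e he
    have h1 := congrArg φ he
    rw [map_sum, map_zero] at h1
    have h2 : ∀ i, φ (c i * (e i : ℂ)) = φ (c i) * e i := by
      intro i
      have : c i * (e i : ℂ) = (e i : ℤ) • c i := by rw [zsmul_eq_mul, mul_comm]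
      rw [this, map_zsmul, zsmul_eq_mul, mul_comm]
    simp only [h2] at h1
    have h3 : ((∑ i ∈ c.support, m i * e i : ℤ) : ℚ) = 0 := by
      push_cast
      simp only [hm, mul_assoc, ← Finset.mul_sum, h1, mul_zero]
    exact_mod_cast h3)
  have ha0 : a ≠ 0 := by
    rintro rfl
    rw [map_zero, Finset.prod_eq_zero_iff] at ha
    obtain ⟨i, _, hi⟩ := ha
    exact zpow_ne_zero _ (hr i) hi
  have hm0 : ∀ i, m i ≠ 0 → i ∈ c.support := by
    intro i hi
    rw [Finsupp.mem_support_iff]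
    intro h
    apply hi
    have := hm i
    rw [h, map_zero, mul_zero] at this
    exact_mod_cast this
  let p : ℕ →₀ ℕ := Finsupp.onFinset c.support (fun i => (m i).toNat) (fun i hi => hm0 i (by
    intro h; simp [h] at hi))
  let q : ℕ →₀ ℕ := Finsupp.onFinset c.support (fun i => (-m i).toNat) (fun i hi => hm0 i (by
    intro h; simp [h] at hi))
  have hpq : p = q := by
    apply hfree p q (Units.mk0 a ha0)
    rw [Finsupp.onFinset_prod _ (by simp), Finsupp.onFinset_prod _ (by simp), Units.val_mk0, ← ha,
      ← Finset.prod_mul_distrib]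
    refine Finset.prod_congr rfl fun i _ => ?_
    rw [← zpow_natCast, ← zpow_natCast, ← zpow_add₀ (hr i)]
    congr 1
    omega
  have h1 := DFunLike.congr_fun hpq i0
  simp only [p, q, Finsupp.onFinset_apply] at h1
  have h2 : m i0 = 0 := by omega
  have h3 := hm i0
  rw [h2] at h3
  simp [hb0, hφ] at h3

/-- Logarithmic differential as a functional on derivations. -/
noncomputable def pcDlog (K : Type*) [Field K] [Algebra ℂ K] (r : K) : Derivation ℂ K K →ₗ[K] K where
  toFun X := X r / r
  map_add' X Y := by simp [add_div]
  map_smul' f X := by simp [mul_div_assoc]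

/-- Lie derivative of a functional on derivations. -/
noncomputable def pcLie (K : Type*) [Field K] [Algebra ℂ K] (δ : Derivation ℂ K K) :
    (Derivation ℂ K K →ₗ[K] K) →+ (Derivation ℂ K K →ₗ[K] K) where
  toFun ω :=
    { toFun := fun X => δ (ω X) - ω ⁅δ, X⁆
      map_add' := fun X Y => by
        rw [lie_add]; simp only [map_add]; ring
      map_smul' := fun f X => by
        have : ⁅δ, f • X⁆ = δ f • X + f • ⁅δ, X⁆ := by
          ext a
          simp only [Derivation.commutator_apply, Derivation.smul_apply, Derivation.add_apply,
            smul_eq_mul, Derivation.leibniz]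
          ring
        rw [this]
        simp only [map_add, map_smul, smul_eq_mul, Derivation.leibniz, RingHom.id_apply]
        ring }
  map_zero' := by ext X; simp
  map_add' ω η := by
    ext X
    simp only [LinearMap.add_apply, map_add, LinearMap.coe_mk, AddHom.coe_mk]
    ring

theorem pcLie_apply (K : Type*) [Field K] [Algebra ℂ K] (δ : Derivation ℂ K K)
    (ω : Derivation ℂ K K →ₗ[K] K) (X : Derivation ℂ K K) :
    pcLie K δ ω X = δ (ω X) - ω ⁅δ, X⁆ := rfl

theorem pc_final (K : Type*) [Field K] [Algebra ℂ K] [Algebra.EssFiniteType ℂ K]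
    (m : ℕ) (δ : Fin m → Derivation ℂ K K)
    (hconst : ∀ f, (∀ j, δ j f = 0) → ∃ c, f = algebraMap ℂ K c)
    (r : ℕ → K) (hr : ∀ i, r i ≠ 0)
    (hfree : ∀ (a b : ℕ →₀ ℕ) (lam : ℂˣ),
      (a.prod fun i e => r i ^ e) = algebraMap ℂ K (lam : ℂ) * (b.prod fun i e => r i ^ e) →
      a = b)
    (W : Fin m → Submodule ℂ K) (hWf : ∀ j, Module.Finite ℂ (W j))
    (hW : ∀ j i, δ j (r i) / r i ∈ W j) : False := by
  have : Module.Finite K (Derivation ℂ K K) :=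
    Module.Finite.equiv (KaehlerDifferential.linearMapEquivDerivation ℂ K)
  let Φ : (ℕ →₀ ℂ) →ₗ[ℂ] (∀ j, W j) :=
    Finsupp.linearCombination ℂ (fun i j => ⟨δ j (r i) / r i, hW j i⟩)
  let Ψ : (ℕ →₀ ℂ) →ₗ[ℂ] (Derivation ℂ K K →ₗ[K] K) :=
    Finsupp.linearCombination ℂ (fun i => pcDlog K (r i))
  have hΨ : Function.Injective Ψ := by
    rw [← LinearMap.ker_eq_bot, LinearMap.ker_eq_bot']
    intro c hc
    apply pc_inj K r hr hfree c
    intro D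
    have := LinearMap.congr_fun hc D
    rw [Finsupp.linearCombination_apply, Finsupp.sum, LinearMap.sum_apply] at this
    exact this
  have hLie : ∀ j c X, pcLie K (δ j) (Ψ c) X = X ((Φ c j : W j) : K) := by
    intro j c X
    induction c using Finsupp.induction_linear with
    | zero => simp
    | add f g hf hg => 
      simp only [map_add, LinearMap.add_apply, hf, hg, Pi.add_apply, Submodule.coe_add]
    | single i a =>
      simp only [Φ, Ψ, Finsupp.linearCombination_single, pcLie_apply, LinearMap.smul_apply,
        Pi.smul_apply, Submodule.coe_smul, Derivation.map_smul, ← smul_sub]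
      congr 1
      simp only [pcDlog, LinearMap.coe_mk, AddHom.coe_mk, Derivation.commutator_apply,
        Derivation.leibniz_div, smul_eq_mul]
      have := hr i
      field_simp
      ring
  let b := Module.Basis.ofVectorSpace ℂ (LinearMap.ker Φ)
  have hli : LinearIndependent ℂ (fun k => Ψ (b k)) := by
    have h1 : LinearIndependent ℂ (fun k => ((b k : LinearMap.ker Φ) : ℕ →₀ ℂ)) :=
      b.linearIndependent.map' (LinearMap.ker Φ).subtype (Submodule.ker_subtype _)
    exact h1.map' Ψ (LinearMap.ker_eq_bot.2 hΨ)
  have hli2 := pc_lie K (Derivation ℂ K K →ₗ[K] K) δ hconst (fun j => pcLie K (δ j)) (by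
    intro j f v
    ext X
    simp only [pcLie_apply, LinearMap.smul_apply, LinearMap.add_apply, smul_eq_mul, Derivation.leibniz]
    ring) (fun k => Ψ (b k)) (by
    intro j k
    ext X
    rw [hLie]
    have : Φ (b k) = 0 := (b k).2
    rw [this]
    simp) hli
  have hfin : Finite (Module.Basis.ofVectorSpaceIndex ℂ (LinearMap.ker Φ)) := hli2.finite
  have h1 : Module.Finite ℂ (LinearMap.ker Φ) := Module.Finite.of_basis b
  have h2 : Module.Finite ℂ ((ℕ →₀ ℂ) ⧸ LinearMap.ker Φ) :=
    Module.Finite.equiv Φ.quotKerEquivRange.symm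
  have h3 : Module.Finite ℂ (ℕ →₀ ℂ) := Module.Finite.of_submodule_quotient (LinearMap.ker Φ)
  have h4 : Finite ℕ := Module.Finite.finite_basis (Finsupp.basisSingleOne (R := ℂ) (ι := ℕ))
  exact not_finite ℕ

/-- Let `A` be an integrally closed affine `ℂ`-algebra with `ℂ`-linear
derivations `δ 1, …, δ m`.  Suppose there is an infinite sequence `r 0, r 1, …` of nonzero
elements of `A` with `δ j (r i) / r i ∈ A` (i.e. `r i ∣ δ j (r i)`) for all `i, j`, whose
images in `(A ∖ {0}) / ℂˣ` freely generate a free abelian semigroup: whenever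
`∏ (r i)^(a i) = λ · ∏ (r i)^(b i)` for some `λ ∈ ℂˣ` and finitely supported exponents
`a, b`, one has `a = b`.  Then there is `f ∈ Frac(A) ∖ ℂ` with `δ j f = 0` for all `j`.
The conclusion is expressed via a representation `f = x / y`: the unique extension of
`δ j` to `Frac(A)` kills `x / y` iff `δ j x * y = x * δ j y`, and `x / y` lies in `ℂ` iff
`x = c • y` for some `c : ℂ`. -/
theorem principal_case_gives_constant
    (A : Type*) [CommRing A] [IsDomain A] [Algebra ℂ A] [IsIntegrallyClosed A]
    (hfg : Algebra.FiniteType ℂ A)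
    (m : ℕ) (δ : Fin m → Derivation ℂ A A)
    (r : ℕ → A)
    (hne : ∀ i : ℕ, r i ≠ 0)
    (hdvd : ∀ (j : Fin m) (i : ℕ), r i ∣ δ j (r i))
    (hfree : ∀ (a b : ℕ →₀ ℕ) (lam : ℂˣ),
      (a.prod fun i e => r i ^ e) = algebraMap ℂ A (lam : ℂ) * (b.prod fun i e => r i ^ e) →
      a = b) :
    ∃ x y : A, y ≠ 0 ∧ (¬ ∃ c : ℂ, x = algebraMap ℂ A c * y) ∧
      ∀ j : Fin m, δ j x * y = x * δ j y := by
  by_contra hcon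
  push Not at hcon
  let K := FractionRing A
  have inj : Function.Injective (algebraMap A K) := IsFractionRing.injective A K
  have : Algebra.EssFiniteType ℂ K := inferInstance
  have : Algebra.FormallyEtale A K := Algebra.FormallyEtale.of_isLocalization (nonZeroDivisors A)
  choose D hD using fun j => pc_ext ℂ A K ((Algebra.linearMap A K).compDer (δ j))
  have hD' : ∀ j a, D j (algebraMap A K a) = algebraMap A K (δ j a) := fun j a => hD j a
  have hne' : ∀ i, algebraMap A K (r i) ≠ 0 := fun i => by
    rw [Ne, map_eq_zero_iff _ inj]; exact hne i
  choose W hWf hW using fun j => pc_bound A K (D j)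
  refine pc_final K m D ?_ (fun i => algebraMap A K (r i)) hne' ?_ W hWf ?_
  · intro f hf
    obtain ⟨x, y, hy, rfl⟩ := IsFractionRing.div_surjective (A := A) f
    have hy0 : y ≠ 0 := nonZeroDivisors.ne_zero hy
    have hyK : algebraMap A K y ≠ 0 := by rw [Ne, map_eq_zero_iff _ inj]; exact hy0
    by_cases h : ∃ c : ℂ, x = algebraMap ℂ A c * y
    · obtain ⟨c, hc⟩ := h
      refine ⟨c, ?_⟩
      rw [hc, map_mul, mul_div_cancel_right₀ _ hyK, ← IsScalarTower.algebraMap_apply]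
    · exfalso
      obtain ⟨j, hj⟩ := hcon x y hy0 (by simpa using h)
      apply hj
      apply inj
      have h1 := hf j
      rw [Derivation.leibniz_div, hD', hD', smul_eq_mul, smul_eq_mul, smul_eq_mul] at h1
      rw [map_mul, map_mul]
      have h2 : (algebraMap A K y)⁻¹ ^ 2 ≠ 0 := pow_ne_zero 2 (inv_ne_zero hyK)
      have h3 := (mul_eq_zero.1 h1).resolve_left h2
      linear_combination h3
  · intro a b lam h
    apply hfree a b lam
    apply inj
    rw [map_mul, ← IsScalarTower.algebraMap_apply]
    simpa [Finsupp.prod] using h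
  · intro j i
    refine hW j _ (hne' i) ?_
    obtain ⟨q, hq⟩ := hdvd j i
    refine ⟨q, ?_⟩
    rw [hD', hq, map_mul, mul_div_cancel_left₀ _ (hne' i)]
end
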